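/- Let Ω₀ ⊆ ℝⁿ_t × ℝᵐ_x be a convex domain, let p₀: Ω₀ → ℝⁿ_t be the natural projection, and let Ω_{0,t} = {x ∈ ℝᵐ : (t,x) ∈ Ω₀} for t ∈ D₀ := p₀(Ω₀). Let g̃(t,x): Ω₀ → GL(r,ℂ) be a C² Hermitian metric (positive definite Hermitian matrix valued) on the trivial vector bundle Ẽ₀ = Ω₀ × ℂʳ, and let g(t) = ∫_{Ω_{0,t}} g̃(t,x) dV_x (entrywise integration) define an Hermitian metric on the trivial bundle E₀ = D₀ × ℂʳ over D₀. If (Ẽ₀, g̃) is Nakano semi-positive in the real sense and g is C², then (E₀, g) is Nakano semi-positive in the real sense. -/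

import Mathlib

open MeasureTheory
open scoped ENNReal ComplexOrder

noncomputable section

/-- Partial derivative `∂f/∂x_j` of a complex-matrix-entry function of real variables. -/
def realPD {N : ℕ} (j : Fin N) (f : (Fin N → ℝ) → ℂ) (p : Fin N → ℝ) : ℂ :=
  fderiv ℝ f p (Pi.single j 1)

/-- Entrywise partial derivative `∂G/∂x_j` of a matrix-valued function. -/
def matRealPD {N r : ℕ} (j : Fin N) (G : (Fin N → ℝ) → Matrix (Fin r) (Fin r) ℂ)
    (p : Fin N → ℝ) : Matrix (Fin r) (Fin r) ℂ :=
  Matrix.of fun a b => realPD j (fun q => G q a b) p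

/-- Curvature coefficient in the real sense: `Θ^G_{jk} = -∂/∂x_k (G⁻¹ ∂G/∂x_j)`. -/
def realChernCurv {N r : ℕ} (G : (Fin N → ℝ) → Matrix (Fin r) (Fin r) ℂ) (j k : Fin N)
    (p : Fin N → ℝ) : Matrix (Fin r) (Fin r) ℂ :=
  Matrix.of fun a b => - realPD k (fun q => ((G q)⁻¹ * matRealPD j G q) a b) p

/-- A `C²` Hermitian metric on the trivial bundle `Ω × ℂʳ` over `Ω ⊆ ℝᴺ`: positive
definite Hermitian matrix valued and `C²` entrywise. -/
def IsHermitianMetricReal {N r : ℕ} (Ω : Set (Fin N → ℝ))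
    (G : (Fin N → ℝ) → Matrix (Fin r) (Fin r) ℂ) : Prop :=
  (∀ p ∈ Ω, (G p).PosDef) ∧ ∀ a b : Fin r, ContDiffOn ℝ 2 (fun q => G q a b) Ω

/-- Nakano semi-positivity in the real sense: `∑_{j,k} (Θ^G_{jk} u_j, u_k)_G ≥ 0` at every
point of `Ω`, where `(v, w)_G = w* G v`. -/
def NakanoSemiPositiveReal {N r : ℕ} (Ω : Set (Fin N → ℝ))
    (G : (Fin N → ℝ) → Matrix (Fin r) (Fin r) ℂ) : Prop :=
  ∀ p ∈ Ω, ∀ u : Fin N → Fin r → ℂ,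
    0 ≤ (∑ j : Fin N, ∑ k : Fin N, ∑ a : Fin r, ∑ b : Fin r,
      star (u k b) * G p b a * Matrix.mulVec (realChernCurv G j k p) (u j) a).re

section MatrixCalculus

open scoped Matrix

section OperatorNorm

open scoped Matrix.Norms.Operator

theorem exists_hasFDerivAt_inv_of_operatorNorm {E : Type*} [NormedAddCommGroup E]
    [NormedSpace ℝ E] {r : ℕ} {A : E → Matrix (Fin r) (Fin r) ℂ}
    {A' : E →L[ℝ] Matrix (Fin r) (Fin r) ℂ} {p : E}
    (hA : HasFDerivAt A A' p) (hu : IsUnit (A p)) :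
    ∃ L : E →L[ℝ] Matrix (Fin r) (Fin r) ℂ, HasFDerivAt (fun q => (A q)⁻¹) L p ∧
      ∀ e, L e = -((A p)⁻¹ * A' e * (A p)⁻¹) := by
  have hc : HasSummableGeomSeries (Matrix (Fin r) (Fin r) ℂ) := inferInstance
  obtain ⟨U, hU⟩ := hu
  have h1 := hasFDerivAt_ringInverse (𝕜 := ℝ) U
  rw [hU] at h1
  have h2 := h1.comp p hA
  refine ⟨_, h2.congr_of_eventuallyEq (Filter.Eventually.of_forall fun q => ?_), ?_⟩
  · simp [Matrix.nonsing_inv_eq_ringInverse]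
  · intro e
    rw [← hU, ← Matrix.coe_units_inv]
    rfl

theorem exists_hasFDerivAt_mul_of_operatorNorm {E : Type*} [NormedAddCommGroup E]
    [NormedSpace ℝ E] {r : ℕ} {A B : E → Matrix (Fin r) (Fin r) ℂ}
    {A' B' : E →L[ℝ] Matrix (Fin r) (Fin r) ℂ} {p : E}
    (hA : HasFDerivAt A A' p) (hB : HasFDerivAt B B' p) :
    ∃ L : E →L[ℝ] Matrix (Fin r) (Fin r) ℂ, HasFDerivAt (fun q => A q * B q) L p ∧
      ∀ e, L e = A p * B' e + A' e * B p :=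
  ⟨_, hA.mul' hB, fun _ => rfl⟩

end OperatorNorm

open scoped Matrix.Norms.Elementwise

/-- The derivative of the matrix inverse, for the entrywise norm. -/
theorem exists_hasFDerivAt_inv {E : Type*} [NormedAddCommGroup E] [NormedSpace ℝ E] {r : ℕ}
    {A : E → Matrix (Fin r) (Fin r) ℂ} {A' : E →L[ℝ] Matrix (Fin r) (Fin r) ℂ} {p : E}
    (hA : HasFDerivAt A A' p) (hu : IsUnit (A p)) :
    ∃ L : E →L[ℝ] Matrix (Fin r) (Fin r) ℂ, HasFDerivAt (fun q => (A q)⁻¹) L p ∧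
      ∀ e, L e = -((A p)⁻¹ * A' e * (A p)⁻¹) :=
  exists_hasFDerivAt_inv_of_operatorNorm hA hu

/-- The derivative of a matrix product, for the entrywise norm. -/
theorem exists_hasFDerivAt_mul {E : Type*} [NormedAddCommGroup E] [NormedSpace ℝ E] {r : ℕ}
    {A B : E → Matrix (Fin r) (Fin r) ℂ} {A' B' : E →L[ℝ] Matrix (Fin r) (Fin r) ℂ} {p : E}
    (hA : HasFDerivAt A A' p) (hB : HasFDerivAt B B' p) :
    ∃ L : E →L[ℝ] Matrix (Fin r) (Fin r) ℂ, HasFDerivAt (fun q => A q * B q) L p ∧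
      ∀ e, L e = A p * B' e + A' e * B p :=
  exists_hasFDerivAt_mul_of_operatorNorm hA hB

theorem hasDerivAt_inv_of_isUnit {r : ℕ} {A : ℝ → Matrix (Fin r) (Fin r) ℂ}
    {A' : Matrix (Fin r) (Fin r) ℂ} {x : ℝ} (hA : HasDerivAt A A' x) (hu : IsUnit (A x)) :
    HasDerivAt (fun s => (A s)⁻¹) (-((A x)⁻¹ * A' * (A x)⁻¹)) x := by
  obtain ⟨L, hL, hLe⟩ := exists_hasFDerivAt_inv hA.hasFDerivAt hu
  have h := hL.hasDerivAt
  rw [hLe] at h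
  simpa using h

theorem hasDerivAt_matrix_apply {r : ℕ} {A : ℝ → Matrix (Fin r) (Fin r) ℂ}
    {A' : Matrix (Fin r) (Fin r) ℂ} {x : ℝ} (hA : HasDerivAt A A' x) (a b : Fin r) :
    HasDerivAt (fun s => A s a b) (A' a b) x :=
  hasDerivAt_pi.1 (hasDerivAt_pi.1 hA a) b

theorem hasDerivAt_mulVec {r : ℕ} {A : ℝ → Matrix (Fin r) (Fin r) ℂ}
    {A' : Matrix (Fin r) (Fin r) ℂ} {z : ℝ → Fin r → ℂ} {z' : Fin r → ℂ} {x : ℝ}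
    (hA : HasDerivAt A A' x) (hz : HasDerivAt z z' x) :
    HasDerivAt (fun s => A s *ᵥ z s) (A' *ᵥ z x + A x *ᵥ z') x := by
  refine hasDerivAt_pi.2 fun a => ?_
  simp only [Matrix.mulVec, dotProduct, Pi.add_apply, ← Finset.sum_add_distrib]
  exact HasDerivAt.fun_sum fun b _ =>
    (hasDerivAt_matrix_apply hA a b).mul (hasDerivAt_pi.1 hz b)

theorem hasDerivAt_star_dotProduct {r : ℕ} {y z : ℝ → Fin r → ℂ} {y' z' : Fin r → ℂ} {x : ℝ}
    (hy : HasDerivAt y y' x) (hz : HasDerivAt z z' x) :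
    HasDerivAt (fun s => star (y s) ⬝ᵥ z s) (star y' ⬝ᵥ z x + star (y x) ⬝ᵥ z') x := by
  simp only [dotProduct, ← Finset.sum_add_distrib]
  exact HasDerivAt.fun_sum fun b _ =>
    ((hasDerivAt_pi.1 hy b).star).mul (hasDerivAt_pi.1 hz b)

/-- `A ↦ A *ᵥ u` as a continuous real-linear map. -/
def mulVecCLM {r : ℕ} (u : Fin r → ℂ) : Matrix (Fin r) (Fin r) ℂ →L[ℝ] (Fin r → ℂ) :=
  LinearMap.toContinuousLinearMap
    { toFun := fun A => A *ᵥ u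
      map_add' := fun A B => Matrix.add_mulVec A B u
      map_smul' := fun c A => Matrix.smul_mulVec c A u }

@[simp]
theorem mulVecCLM_apply {r : ℕ} (u : Fin r → ℂ) (A : Matrix (Fin r) (Fin r) ℂ) :
    mulVecCLM u A = A *ᵥ u := rfl

/-- `v ↦ w* v` as a continuous real-linear map. -/
def starDotCLM {r : ℕ} (w : Fin r → ℂ) : (Fin r → ℂ) →L[ℝ] ℂ :=
  LinearMap.toContinuousLinearMap
    { toFun := fun v => star w ⬝ᵥ v
      map_add' := fun u v => dotProduct_add _ u v
      map_smul' := fun c v => dotProduct_smul c _ v }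

@[simp]
theorem starDotCLM_apply {r : ℕ} (w v : Fin r → ℂ) : starDotCLM w v = star w ⬝ᵥ v := rfl

/-- The conjugate-transpose as a continuous real-linear map. -/
def conjTransposeCLM (r : ℕ) :
    Matrix (Fin r) (Fin r) ℂ →L[ℝ] Matrix (Fin r) (Fin r) ℂ :=
  LinearMap.toContinuousLinearMap
    { toFun := fun A => A.conjTranspose
      map_add' := fun A B => Matrix.conjTranspose_add A B
      map_smul' := fun c A => by simp [Matrix.conjTranspose_smul] }

@[simp]
theorem conjTransposeCLM_apply {r : ℕ} (A : Matrix (Fin r) (Fin r) ℂ) :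
    conjTransposeCLM r A = A.conjTranspose := rfl

theorem star_star_dotProduct_mulVec {r : ℕ} (M : Matrix (Fin r) (Fin r) ℂ) (u v : Fin r → ℂ) :
    star (star u ⬝ᵥ M *ᵥ v) = star v ⬝ᵥ M.conjTranspose *ᵥ u := by
  rw [Matrix.star_dotProduct, star_star, Matrix.star_mulVec, ← Matrix.dotProduct_mulVec]

theorem star_dotProduct_inv_mulVec {r : ℕ} {A : Matrix (Fin r) (Fin r) ℂ} (hA : A.PosDef)
    (w : Fin r → ℂ) : star (A *ᵥ w) ⬝ᵥ A⁻¹ *ᵥ (A *ᵥ w) = star w ⬝ᵥ A *ᵥ w := by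
  rw [Matrix.mulVec_mulVec, Matrix.nonsing_inv_mul _ ((Matrix.isUnit_iff_isUnit_det A).1 hA.isUnit),
    Matrix.one_mulVec, Matrix.star_mulVec, hA.isHermitian.eq, Matrix.dotProduct_mulVec]

/-- The value `v* A⁻¹ v - H` of the Nakano form of a metric with value `A`, first-order
contraction `v` and second-order contraction `H`. -/
def nakanoValue {r : ℕ} (A : Matrix (Fin r) (Fin r) ℂ) (v : Fin r → ℂ) (H : ℂ) : ℝ :=
  (star v ⬝ᵥ A⁻¹ *ᵥ v - H).re

/-- One-variable marginals: if the Nakano form in the directions of a family together with the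
integration variable is nonnegative over an interval, then so is the Nakano form of the
integrated data. -/
theorem nakanoValue_intervalIntegral_nonneg {r : ℕ} {a b : ℝ} (hab : a ≤ b)
    {A A1 A2 : ℝ → Matrix (Fin r) (Fin r) ℂ} {h h1 : ℝ → Fin r → ℂ} {H : ℝ → ℂ}
    (hA : ∀ x, HasDerivAt A (A1 x) x) (hA1 : ∀ x, HasDerivAt A1 (A2 x) x)
    (hh : ∀ x, HasDerivAt h (h1 x) x) (hH : Continuous H)
    (hherm : ∀ x, (A x).IsHermitian) (hpos : ∀ x ∈ Set.Icc a b, (A x).PosDef)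
    (hN : ∀ x ∈ Set.Icc a b, ∀ y : Fin r → ℂ, 0 ≤ nakanoValue (A x) (h x + A1 x *ᵥ y)
      (H x + 2 * (star y ⬝ᵥ h1 x) + star y ⬝ᵥ A2 x *ᵥ y))
    (hG : (∫ x in a..b, A x).PosDef) :
    0 ≤ nakanoValue (∫ x in a..b, A x) (∫ x in a..b, h x) (∫ x in a..b, H x) := by
  have cA : Continuous A := continuous_iff_continuousAt.2 fun x => (hA x).continuousAt
  have ch : Continuous h := continuous_iff_continuousAt.2 fun x => (hh x).continuousAt
  have hherm1 : ∀ x, (A1 x).conjTranspose = A1 x := fun x => by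
    have e : (fun s => conjTransposeCLM r (A s)) = A := funext fun s => (hherm s).eq
    have h2 := (conjTransposeCLM r).hasFDerivAt.comp_hasDerivAt x (hA x)
    exact HasDerivAt.unique (f := A) (e ▸ h2) (hA x)
  set G := ∫ x in a..b, A x with hGdef
  set c := G⁻¹ *ᵥ ∫ x in a..b, h x with hc
  have hGc : G *ᵥ c = ∫ x in a..b, h x := by
    rw [hc, Matrix.mulVec_mulVec,
      Matrix.mul_nonsing_inv _ ((Matrix.isUnit_iff_isUnit_det G).1 hG.isUnit), Matrix.one_mulVec]
  have cAc : Continuous fun x => A x *ᵥ c := (mulVecCLM c).continuous.comp cA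
  have ccAc : Continuous fun x => star c ⬝ᵥ A x *ᵥ c := (starDotCLM c).continuous.comp cAc
  set z : ℝ → Fin r → ℂ := fun x => ∫ s in a..x, (A s *ᵥ c - h s) with hz
  have hz' : ∀ x, HasDerivAt z (A x *ᵥ c - h x) x := fun x =>
    ((cAc.sub ch).integral_hasStrictDerivAt a x).hasDerivAt
  have hza : z a = 0 := by simp [hz]
  have hIAc : ∫ s in a..b, A s *ᵥ c = G *ᵥ c :=
    (mulVecCLM c).intervalIntegral_comp_comm (cA.intervalIntegrable a b)
  have hIcAc : ∫ s in a..b, star c ⬝ᵥ A s *ᵥ c = star c ⬝ᵥ G *ᵥ c := by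
    rw [← hIAc]
    exact (starDotCLM c).intervalIntegral_comp_comm (cAc.intervalIntegrable a b)
  have hzb : z b = 0 := by
    simp only [hz]
    rw [intervalIntegral.integral_sub (cAc.intervalIntegrable a b) (ch.intervalIntegrable a b),
      hIAc, hGc, sub_self]
  set y : ℝ → Fin r → ℂ := fun x => (A x)⁻¹ *ᵥ z x with hy
  set yd : ℝ → Fin r → ℂ := fun x => (A x)⁻¹ *ᵥ (A x *ᵥ c - h x - A1 x *ᵥ y x) with hyd
  have hy' : ∀ x ∈ Set.Icc a b, HasDerivAt y (yd x) x := fun x hx => by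
    have := hasDerivAt_mulVec (hasDerivAt_inv_of_isUnit (hA x) (hpos x hx).isUnit) (hz' x)
    convert this using 1
    simp only [hyd, hy, Matrix.mulVec_sub, Matrix.neg_mulVec, Matrix.mulVec_mulVec, mul_assoc]
    abel
  set B : ℝ → ℂ := fun x => 2 * (star (y x) ⬝ᵥ h x) + star (y x) ⬝ᵥ A1 x *ᵥ y x with hB
  set Bd : ℝ → ℂ := fun x => 2 * (star (yd x) ⬝ᵥ h x + star (y x) ⬝ᵥ h1 x) +
    (star (yd x) ⬝ᵥ A1 x *ᵥ y x + star (y x) ⬝ᵥ (A2 x *ᵥ y x + A1 x *ᵥ yd x)) with hBd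
  have hB' : ∀ x ∈ Set.Icc a b, HasDerivAt B (Bd x) x := fun x hx =>
    ((hasDerivAt_star_dotProduct (hy' x hx) (hh x)).const_mul 2).add
      (hasDerivAt_star_dotProduct (hy' x hx) (hasDerivAt_mulVec (hA1 x) (hy' x hx)))
  set Φ : ℝ → ℝ := fun x => ((∫ s in a..x, (star c ⬝ᵥ A s *ᵥ c - H s)) - B x).re with hΦ
  have hΦ' : ∀ x ∈ Set.Icc a b, HasDerivAt Φ ((star c ⬝ᵥ A x *ᵥ c - H x) - Bd x).re x :=
    fun x hx => Complex.reCLM.hasFDerivAt.comp_hasDerivAt x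
      ((((ccAc.sub hH).integral_hasStrictDerivAt a x).hasDerivAt).sub (hB' x hx))
  have hnn : ∀ x ∈ Set.Icc a b, 0 ≤ ((star c ⬝ᵥ A x *ᵥ c - H x) - Bd x).re := fun x hx => by
    have hF := hN x hx (y x)
    have hP := (hpos x hx)
    have hAyd : A x *ᵥ yd x = A x *ᵥ c - h x - A1 x *ᵥ y x := by
      simp only [hyd]
      rw [Matrix.mulVec_mulVec, Matrix.mul_nonsing_inv _
        ((Matrix.isUnit_iff_isUnit_det _).1 hP.isUnit), Matrix.one_mulVec]
    have hheq : h x = A x *ᵥ c - A x *ᵥ yd x - A1 x *ᵥ y x := by rw [hAyd]; abel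
    have hw : h x + A1 x *ᵥ y x = A x *ᵥ (c - yd x) := by
      rw [hheq, Matrix.mulVec_sub]; abel
    have e1 : (star c ⬝ᵥ A x *ᵥ yd x).re = (star (yd x) ⬝ᵥ A x *ᵥ c).re := by
      have := star_star_dotProduct_mulVec (A x) c (yd x)
      rw [(hherm x).eq] at this
      rw [← this]; simp
    have e2 : (star (y x) ⬝ᵥ A1 x *ᵥ yd x).re = (star (yd x) ⬝ᵥ A1 x *ᵥ y x).re := by
      have := star_star_dotProduct_mulVec (A1 x) (y x) (yd x)
      rw [hherm1 x] at this
      rw [← this]; simp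
    have e3 : 0 ≤ (star (yd x) ⬝ᵥ A x *ᵥ yd x).re :=
      (Complex.le_def.1 (hP.posSemidef.dotProduct_mulVec_nonneg (yd x))).1
    rw [nakanoValue, hw, star_dotProduct_inv_mulVec hP] at hF
    simp only [hBd]
    rw [hheq]
    simp only [Matrix.mulVec_sub, star_sub, sub_dotProduct, dotProduct_sub, dotProduct_add,
      Complex.sub_re, Complex.add_re, Complex.re_ofNat, Complex.im_ofNat, Complex.mul_re, zero_mul, sub_zero] at hF ⊢
    linarith
  have hmono : MonotoneOn Φ (Set.Icc a b) := by
    refine monotoneOn_of_deriv_nonneg (convex_Icc a b)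
      (fun x hx => (hΦ' x hx).continuousAt.continuousWithinAt)
      (fun x hx => (hΦ' x (interior_subset hx)).differentiableAt.differentiableWithinAt)
      (fun x hx => ?_)
    rw [(hΦ' x (interior_subset hx)).deriv]
    exact hnn x (interior_subset hx)
  have hfin := hmono (Set.left_mem_Icc.2 hab) (Set.right_mem_Icc.2 hab) hab
  have hya : y a = 0 := by simp [hy, hza]
  have hyb : y b = 0 := by simp [hy, hzb]
  simp only [hΦ, hB, hya, hyb] at hfin
  rw [intervalIntegral.integral_sub (ccAc.intervalIntegrable a b) (hH.intervalIntegrable a b),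
    hIcAc] at hfin
  rw [nakanoValue, ← hGc, star_dotProduct_inv_mulVec hG]
  simpa using hfin

end MatrixCalculus

section Jets

open scoped Matrix Matrix.Norms.Elementwise Topology

variable {E : Type*} [NormedAddCommGroup E] [NormedSpace ℝ E] {r : ℕ}

/-- The first-order contraction `∑ ∂_{e i} g · u i`. -/
def jetOne (g : E → Matrix (Fin r) (Fin r) ℂ) (p : E) {k : ℕ} (e : Fin k → E)
    (u : Fin k → Fin r → ℂ) : Fin r → ℂ :=
  ∑ i, fderiv ℝ g p (e i) *ᵥ u i

/-- The second-order contraction `∑ (u j)* ∂_{e j} ∂_{e i} g · u i`. -/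
def jetTwo (g : E → Matrix (Fin r) (Fin r) ℂ) (p : E) {k : ℕ} (e : Fin k → E)
    (u : Fin k → Fin r → ℂ) : ℂ :=
  ∑ i, ∑ j, star (u j) ⬝ᵥ fderiv ℝ (fun q => fderiv ℝ g q (e i)) p (e j) *ᵥ u i

/-- Coordinate-free Nakano semi-positivity at a point. -/
def NakanoAt (g : E → Matrix (Fin r) (Fin r) ℂ) (p : E) : Prop :=
  ∀ (k : ℕ) (e : Fin k → E) (u : Fin k → Fin r → ℂ),
    0 ≤ nakanoValue (g p) (jetOne g p e u) (jetTwo g p e u)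

theorem conjTranspose_fderiv {g : E → Matrix (Fin r) (Fin r) ℂ} {p : E}
    (hd : DifferentiableAt ℝ g p) (hg : ∀ᶠ q in 𝓝 p, (g q).IsHermitian) (e : E) :
    (fderiv ℝ g p e).conjTranspose = fderiv ℝ g p e := by
  have h1 := (conjTransposeCLM r).hasFDerivAt.comp p hd.hasFDerivAt
  have h2 := h1.congr_of_eventuallyEq (f₁ := g) (hg.mono fun q hq => hq.eq.symm)
  exact (DFunLike.congr_fun (h2.unique hd.hasFDerivAt) e)

theorem fderiv_matrix_apply {g : E → Matrix (Fin r) (Fin r) ℂ} {p : E}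
    (hd : DifferentiableAt ℝ g p) (a b : Fin r) (e : E) :
    fderiv ℝ (fun q => g q a b) p e = fderiv ℝ g p e a b := by
  rw [(hasFDerivAt_pi'.1 (hasFDerivAt_pi'.1 hd.hasFDerivAt a) b).fderiv]
  rfl

theorem ContDiffAt.differentiableAt_fderiv_apply {F : Type*} [NormedAddCommGroup F]
    [NormedSpace ℝ F] {g : E → F} {p : E} (hg : ContDiffAt ℝ 2 g p) (e : E) :
    DifferentiableAt ℝ (fun q => fderiv ℝ g q e) p :=
  ((hg.fderiv_right (m := 1) (by norm_num)).differentiableAt (by norm_num)).clm_apply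
    (differentiableAt_const e)

theorem ContDiffAt.eventually_differentiableAt {F : Type*} [NormedAddCommGroup F]
    [NormedSpace ℝ F] {g : E → F} {p : E} (hg : ContDiffAt ℝ 2 g p) :
    ∀ᶠ q in 𝓝 p, DifferentiableAt ℝ g q :=
  (hg.eventually (by norm_num)).mono fun _ hq => hq.differentiableAt (by norm_num)

theorem fderiv_fderiv_apply {F : Type*} [NormedAddCommGroup F]
    [NormedSpace ℝ F] {g : E → F} {p : E} (hg : ContDiffAt ℝ 2 g p) (e f : E) :
    fderiv ℝ (fun q => fderiv ℝ g q e) p f = fderiv ℝ (fderiv ℝ g) p f e := by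
  have h : DifferentiableAt ℝ (fderiv ℝ g) p :=
    (hg.fderiv_right (m := 1) (by norm_num)).differentiableAt (by norm_num)
  rw [(h.hasFDerivAt.clm_apply (hasFDerivAt_const e p)).fderiv]
  simp

theorem matrix_fderiv_fderiv_apply {g : E → Matrix (Fin r) (Fin r) ℂ} {p : E}
    (hg : ContDiffAt ℝ 2 g p) (e f : E) :
    fderiv ℝ (fun q => fderiv ℝ g q e) p f = fderiv ℝ (fderiv ℝ g) p f e :=
  fderiv_fderiv_apply hg e f

theorem fderiv_fderiv_apply_comm {F : Type*} [NormedAddCommGroup F]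
    [NormedSpace ℝ F] {g : E → F} {p : E} (hg : ContDiffAt ℝ 2 g p) (e f : E) :
    fderiv ℝ (fun q => fderiv ℝ g q e) p f = fderiv ℝ (fun q => fderiv ℝ g q f) p e := by
  rw [fderiv_fderiv_apply hg, fderiv_fderiv_apply hg]
  exact (hg.isSymmSndFDerivAt (by simp)) f e

theorem realChernCurv_eq {N : ℕ} {G : (Fin N → ℝ) → Matrix (Fin r) (Fin r) ℂ}
    {p : Fin N → ℝ} (hG : ContDiffAt ℝ 2 G p) (hu : IsUnit (G p)) (j k : Fin N) :
    G p * realChernCurv G j k p =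
      fderiv ℝ G p (Pi.single k 1) * (G p)⁻¹ * fderiv ℝ G p (Pi.single j 1) -
        fderiv ℝ (fun q => fderiv ℝ G q (Pi.single j 1)) p (Pi.single k 1) := by
  have hd := hG.differentiableAt (by norm_num)
  obtain ⟨L, hL, hLe⟩ := exists_hasFDerivAt_inv hd.hasFDerivAt hu
  obtain ⟨K, hK, hKe⟩ := exists_hasFDerivAt_mul hL
    (hG.differentiableAt_fderiv_apply (Pi.single j 1)).hasFDerivAt
  have hev : (fun q => (G q)⁻¹ * matRealPD j G q) =ᶠ[𝓝 p]
      fun q => (G q)⁻¹ * fderiv ℝ G q (Pi.single j 1) := by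
    filter_upwards [hG.eventually_differentiableAt] with q hq
    congr 1
    ext a b
    exact fderiv_matrix_apply hq a b _
  have hK' := hK.congr_of_eventuallyEq hev
  have hcurv : realChernCurv G j k p = - K (Pi.single k 1) := by
    ext a b
    simp only [realChernCurv, realPD, Matrix.of_apply, Matrix.neg_apply]
    rw [fderiv_matrix_apply hK'.differentiableAt a b, hK'.fderiv]
  have hdet := (Matrix.isUnit_iff_isUnit_det _).1 hu
  rw [hcurv, hKe, hLe, mul_neg, mul_add, ← mul_assoc, Matrix.mul_nonsing_inv _ hdet, one_mul,
    neg_mul, mul_neg, ← mul_assoc, ← mul_assoc, ← mul_assoc, Matrix.mul_nonsing_inv _ hdet, one_mul]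
  exact (neg_add_rev _ _).trans ((add_comm _ _).trans (by rw [neg_neg]; exact (add_comm _ _).trans rfl))

theorem nakano_sum_eq {N : ℕ} {G : (Fin N → ℝ) → Matrix (Fin r) (Fin r) ℂ}
    {p : Fin N → ℝ} (hG : ContDiffAt ℝ 2 G p) (hpos : ∀ᶠ q in 𝓝 p, (G q).PosDef)
    (u : Fin N → Fin r → ℂ) :
    (∑ j : Fin N, ∑ k : Fin N, ∑ a : Fin r, ∑ b : Fin r,
      star (u k b) * G p b a * Matrix.mulVec (realChernCurv G j k p) (u j) a).re =
    nakanoValue (G p) (jetOne G p (fun i => Pi.single i 1) u)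
      (jetTwo G p (fun i => Pi.single i 1) u) := by
  have hterm : ∀ j k, (∑ a : Fin r, ∑ b : Fin r,
      star (u k b) * G p b a * Matrix.mulVec (realChernCurv G j k p) (u j) a) =
      star (fderiv ℝ G p (Pi.single k 1) *ᵥ u k) ⬝ᵥ
        (G p)⁻¹ *ᵥ (fderiv ℝ G p (Pi.single j 1) *ᵥ u j) -
      star (u k) ⬝ᵥ
        fderiv ℝ (fun q => fderiv ℝ G q (Pi.single j 1)) p (Pi.single k 1) *ᵥ u j := by
    intro j k
    have h1 : (∑ a : Fin r, ∑ b : Fin r,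
        star (u k b) * G p b a * Matrix.mulVec (realChernCurv G j k p) (u j) a) =
        star (u k) ⬝ᵥ (G p * realChernCurv G j k p) *ᵥ u j := by
      rw [← Matrix.mulVec_mulVec, Finset.sum_comm]
      simp only [dotProduct, Matrix.mulVec, Finset.mul_sum, mul_assoc]
      rfl
    rw [h1, realChernCurv_eq hG hpos.self_of_nhds.isUnit, Matrix.sub_mulVec, dotProduct_sub,
      Matrix.star_mulVec, conjTranspose_fderiv (hG.differentiableAt (by norm_num))
        (hpos.mono fun q hq => hq.isHermitian), ← Matrix.dotProduct_mulVec,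
      Matrix.mulVec_mulVec, Matrix.mulVec_mulVec, mul_assoc]
  simp only [hterm, nakanoValue, jetOne, jetTwo, Finset.sum_sub_distrib, star_sum,
    Matrix.mulVec_sum, dotProduct_sum, sum_dotProduct]

theorem nakanoAt_of_basis {N : ℕ} {G : (Fin N → ℝ) → Matrix (Fin r) (Fin r) ℂ}
    {p : Fin N → ℝ} (hG : ContDiffAt ℝ 2 G p)
    (h : ∀ u : Fin N → Fin r → ℂ, 0 ≤ nakanoValue (G p)
      (jetOne G p (fun i => Pi.single i 1) u) (jetTwo G p (fun i => Pi.single i 1) u)) :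
    NakanoAt G p := by
  intro k e u
  convert h (fun j => ∑ i, (e i j : ℂ) • u i) using 1
  have he : ∀ i, e i = ∑ j, e i j • (Pi.single j 1 : Fin N → ℝ) := fun i => by
    conv_lhs => rw [← Finset.univ_sum_single (e i)]
    refine Finset.sum_congr rfl fun j _ => ?_
    rw [← Pi.single_smul', smul_eq_mul, mul_one]
  congr 1
  · simp only [jetOne, Matrix.mulVec_sum]
    rw [Finset.sum_comm]
    refine Finset.sum_congr rfl fun i _ => ?_
    conv_lhs => rw [he i, map_sum, Matrix.sum_mulVec]
    refine Finset.sum_congr rfl fun j _ => ?_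
    rw [map_smul, Matrix.smul_mulVec, Matrix.mulVec_smul]
    ext a
    simp
  · have hi : ∀ i i', star (u i') ⬝ᵥ
        (fderiv ℝ (fun q => fderiv ℝ G q (e i)) p (e i')) *ᵥ u i =
        ∑ j, ∑ j', star ((e i' j' : ℂ) • u i') ⬝ᵥ
          (fderiv ℝ (fun q => fderiv ℝ G q (Pi.single j 1)) p (Pi.single j' 1)) *ᵥ
            ((e i j : ℂ) • u i) := by
      intro i i'
      rw [matrix_fderiv_fderiv_apply hG]
      conv_lhs => rw [he i, he i']
      simp only [map_sum, map_smul, sum_apply, smul_apply,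
        Matrix.sum_mulVec, dotProduct_sum, Matrix.smul_mulVec, Matrix.mulVec_smul,
        dotProduct_smul, star_smul, smul_dotProduct]
      refine Finset.sum_congr rfl fun j _ => ?_
      rw [Finset.smul_sum]
      refine Finset.sum_congr rfl fun j' _ => ?_
      rw [matrix_fderiv_fderiv_apply hG]
      simp only [Complex.star_def, Complex.conj_ofReal, Complex.real_smul, smul_eq_mul]
    simp only [jetTwo, hi, Matrix.mulVec_sum, star_sum, dotProduct_sum, sum_dotProduct]
    simp_rw [Finset.sum_comm (s := (Finset.univ : Finset (Fin k))) (t := (Finset.univ : Finset (Fin N)))]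

end Jets

section JetOperations

open scoped Matrix Matrix.Norms.Elementwise Topology

variable {E : Type*} [NormedAddCommGroup E] [NormedSpace ℝ E] {r : ℕ}

theorem jetOne_congr {g g' : E → Matrix (Fin r) (Fin r) ℂ} {p : E} (h : g =ᶠ[𝓝 p] g') {k : ℕ}
    (e : Fin k → E) (u : Fin k → Fin r → ℂ) : jetOne g p e u = jetOne g' p e u := by
  simp only [jetOne, h.fderiv_eq]

theorem jetTwo_congr {g g' : E → Matrix (Fin r) (Fin r) ℂ} {p : E} (h : g =ᶠ[𝓝 p] g') {k : ℕ}
    (e : Fin k → E) (u : Fin k → Fin r → ℂ) : jetTwo g p e u = jetTwo g' p e u := by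
  have h1 : ∀ i, (fun q => fderiv ℝ g q (e i)) =ᶠ[𝓝 p] fun q => fderiv ℝ g' q (e i) := fun i =>
    (h.fderiv (𝕜 := ℝ)).mono fun q hq => congrArg (fun l : E →L[ℝ] _ => l (e i)) hq
  simp only [jetTwo, (h1 _).fderiv_eq]

theorem NakanoAt.congr_of_eventuallyEq {g g' : E → Matrix (Fin r) (Fin r) ℂ} {p : E}
    (hg : NakanoAt g p) (h : g =ᶠ[𝓝 p] g') : NakanoAt g' p := fun k e u => by
  rw [← jetOne_congr h, ← jetTwo_congr h, ← h.eq_of_nhds]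
  exact hg k e u

theorem NakanoAt.comp_continuousLinearMap {F : Type*} [NormedAddCommGroup F] [NormedSpace ℝ F]
    {g : E → Matrix (Fin r) (Fin r) ℂ} (L : F →L[ℝ] E) {p : F}
    (hg : NakanoAt g (L p)) (hc : ContDiffAt ℝ 2 g (L p)) : NakanoAt (fun q => g (L q)) p := by
  intro k e u
  have h1 : ∀ᶠ q in 𝓝 p, fderiv ℝ (fun q => g (L q)) q = (fderiv ℝ g (L q)).comp L := by
    filter_upwards [L.continuous.continuousAt.eventually hc.eventually_differentiableAt] with q hq
    exact (hq.hasFDerivAt.comp q L.hasFDerivAt).fderiv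
  have h2 : ∀ v w, fderiv ℝ (fun q => fderiv ℝ (fun q => g (L q)) q v) p w =
      fderiv ℝ (fun q => fderiv ℝ g q (L v)) (L p) (L w) := fun v w => by
    have h3 : (fun q => fderiv ℝ (fun q => g (L q)) q v) =ᶠ[𝓝 p]
        fun q => fderiv ℝ g (L q) (L v) := h1.mono fun q hq =>
        congrArg (fun l : F →L[ℝ] _ => l v) hq
    rw [h3.fderiv_eq]
    exact DFunLike.congr_fun (((hc.differentiableAt_fderiv_apply (L v)).hasFDerivAt.comp p
      L.hasFDerivAt).fderiv) w
  have e1 : jetOne (fun q => g (L q)) p e u = jetOne g (L p) (fun i => L (e i)) u := by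
    simp only [jetOne, h1.self_of_nhds]
    rfl
  have e2 : jetTwo (fun q => g (L q)) p e u = jetTwo g (L p) (fun i => L (e i)) u := by
    simp only [jetTwo, h2]
  rw [e1, e2]
  exact hg k _ u

theorem fderiv_exp_neg_smul {F : Type*} [NormedAddCommGroup F] [NormedSpace ℝ F]
    {g : E → F} {ψ : E → ℝ} {p : E}
    (hg : DifferentiableAt ℝ g p) (hψ : DifferentiableAt ℝ ψ p) (e : E) :
    fderiv ℝ (fun q => Real.exp (-ψ q) • g q) p e =
      Real.exp (-ψ p) • (fderiv ℝ g p e - fderiv ℝ ψ p e • g p) := by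
  rw [((hψ.hasFDerivAt.fun_neg.exp).fun_smul hg.hasFDerivAt).fderiv]
  simp [smul_smul, sub_eq_add_neg]

theorem fderiv_fderiv_exp_neg_smul {F : Type*} [NormedAddCommGroup F] [NormedSpace ℝ F]
    {g : E → F} {ψ : E → ℝ} {p : E}
    (hg : ContDiffAt ℝ 2 g p) (hψ : ContDiffAt ℝ 2 ψ p) (e f : E) :
    fderiv ℝ (fun q => fderiv ℝ (fun q => Real.exp (-ψ q) • g q) q e) p f =
      Real.exp (-ψ p) • (fderiv ℝ (fun q => fderiv ℝ g q e) p f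
        - fderiv ℝ (fun q => fderiv ℝ ψ q e) p f • g p - fderiv ℝ ψ p e • fderiv ℝ g p f
        - fderiv ℝ ψ p f • (fderiv ℝ g p e - fderiv ℝ ψ p e • g p)) := by
  have h1 : (fun q => fderiv ℝ (fun q => Real.exp (-ψ q) • g q) q e) =ᶠ[𝓝 p]
      fun q => Real.exp (-ψ q) • (fderiv ℝ g q e - fderiv ℝ ψ q e • g q) := by
    filter_upwards [hg.eventually_differentiableAt, hψ.eventually_differentiableAt] with q h h'
    exact fderiv_exp_neg_smul h h' e
  have hg1 := hg.differentiableAt (by norm_num)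
  have hψ1 := hψ.differentiableAt (by norm_num)
  have hg2 := hg.differentiableAt_fderiv_apply e
  have hψ2 := hψ.differentiableAt_fderiv_apply e
  rw [h1.fderiv_eq, fderiv_exp_neg_smul (hg2.fun_sub (hψ2.fun_smul hg1)) hψ1]
  have h2 := (hg2.hasFDerivAt.fun_sub (hψ2.hasFDerivAt.fun_smul hg1.hasFDerivAt)).fderiv
  have h3 : fderiv ℝ (fun q => fderiv ℝ g q e - fderiv ℝ ψ q e • g q) p f = _ :=
    DFunLike.congr_fun h2 f
  congr 2
  rw [h3]
  simp
  abel

theorem ConvexOn.fderiv_fderiv_nonneg {U : Set E} (hU : IsOpen U) {ψ : E → ℝ}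
    (hψ : ConvexOn ℝ U ψ) (hc : ContDiffOn ℝ 2 ψ U) {p : E} (hp : p ∈ U) (e : E) :
    0 ≤ fderiv ℝ (fun q => fderiv ℝ ψ q e) p e := by
  set l : ℝ → E := fun t => p + t • e with hl
  have hlc : Continuous l := by fun_prop
  have hl0 : l 0 = p := by simp [hl]
  have hl' : ∀ t, HasDerivAt l e t := fun t => by
    simpa [hl] using ((hasDerivAt_id' t).smul_const e).const_add p
  set V := l ⁻¹' U with hV
  have hVo : IsOpen V := hU.preimage hlc
  have hcat : ∀ q ∈ U, ContDiffAt ℝ 2 ψ q := fun q hq => hc.contDiffAt (hU.mem_nhds hq)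
  have hVψ : ConvexOn ℝ V (ψ ∘ l) := by
    have : l = AffineMap.lineMap p (p + e) := by
      ext t; simp [hl, AffineMap.lineMap_apply, add_comm]
    rw [hV, this]
    exact hψ.comp_affineMap _
  have hd : ∀ t ∈ V, HasDerivAt (ψ ∘ l) (fderiv ℝ ψ (l t) e) t := fun t ht =>
    ((hcat _ ht).differentiableAt (by norm_num)).hasFDerivAt.comp_hasDerivAt t (hl' t)
  have hmono : MonotoneOn (fun t => fderiv ℝ ψ (l t) e) V := by
    have := hVψ.monotoneOn_deriv fun t ht => (hd t ht).differentiableAt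
    exact this.congr fun t ht => (hd t ht).deriv
  have hd2 : HasDerivAt (fun t => fderiv ℝ ψ (l t) e)
      (fderiv ℝ (fun q => fderiv ℝ ψ q e) p e) 0 := by
    have h := (hcat p hp).differentiableAt_fderiv_apply e
    rw [← hl0] at h
    have := h.hasFDerivAt.comp_hasDerivAt (0 : ℝ) (hl' 0)
    rwa [hl0] at this
  have h0 : V ∈ 𝓝 (0 : ℝ) := hVo.mem_nhds (by simpa [hV, hl0] using hp)
  have := hmono.derivWithin_nonneg (x := 0)
  rwa [derivWithin_of_mem_nhds h0, hd2.deriv] at this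

end JetOperations

section Weights

open scoped Matrix Topology

variable {E : Type*} [NormedAddCommGroup E] [NormedSpace ℝ E] {r : ℕ}

open scoped MatrixOrder in
theorem Matrix.PosSemidef.exists_conjTranspose_mul_self {A : Matrix (Fin r) (Fin r) ℂ}
    (hA : A.PosSemidef) : ∃ B : Matrix (Fin r) (Fin r) ℂ, A = B.conjTranspose * B := by
  obtain ⟨B, hB⟩ := CStarAlgebra.nonneg_iff_eq_star_mul_self.mp hA.nonneg
  exact ⟨B, hB⟩

/-- The tensor product of a real positive semi-definite form and a Hermitian positive
semi-definite form is positive semi-definite. -/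
theorem sum_smul_star_dotProduct_nonneg (Q : E →L[ℝ] E →L[ℝ] ℝ) (hQ : ∀ x, 0 ≤ Q x x)
    {A : Matrix (Fin r) (Fin r) ℂ} (hA : A.PosSemidef) {k : ℕ} (e : Fin k → E)
    (u : Fin k → Fin r → ℂ) :
    0 ≤ (∑ i, ∑ j, Q (e i) (e j) • (star (u j) ⬝ᵥ A *ᵥ u i)).re := by
  obtain ⟨B, rfl⟩ := hA.exists_conjTranspose_mul_self
  have h1 : ∀ i j, (star (u j) ⬝ᵥ (B.conjTranspose * B) *ᵥ u i).re =
      ∑ c, ((B *ᵥ u i) c).re * ((B *ᵥ u j) c).re + ∑ c, ((B *ᵥ u i) c).im * ((B *ᵥ u j) c).im := by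
    intro i j
    rw [← Matrix.mulVec_mulVec, Matrix.dotProduct_mulVec, ← Matrix.star_mulVec]
    simp only [dotProduct, Complex.re_sum, ← Finset.sum_add_distrib]
    refine Finset.sum_congr rfl fun c _ => ?_
    simp [Complex.mul_re]
    ring
  have h2 : ∀ x : Fin k → ℝ, 0 ≤ ∑ i, ∑ j, Q (e i) (e j) * (x i * x j) := by
    intro x
    have := hQ (∑ i, x i • e i)
    simp only [map_sum, map_smul, sum_apply, smul_apply, smul_eq_mul] at this
    convert this using 1
    simp only [Finset.mul_sum]
    rw [Finset.sum_comm]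
    refine Finset.sum_congr rfl fun i _ => ?_
    refine Finset.sum_congr rfl fun j _ => ?_
    ring
  have h3 : (∑ i, ∑ j, Q (e i) (e j) • (star (u j) ⬝ᵥ (B.conjTranspose * B) *ᵥ u i)).re =
      ∑ c, ((∑ i, ∑ j, Q (e i) (e j) * (((B *ᵥ u i) c).re * ((B *ᵥ u j) c).re)) +
        ∑ i, ∑ j, Q (e i) (e j) * (((B *ᵥ u i) c).im * ((B *ᵥ u j) c).im)) := by
    simp only [Complex.re_sum, Complex.smul_re, h1, smul_eq_mul, mul_add, Finset.mul_sum,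
      Finset.sum_add_distrib]
    congr 1 <;>
    · simp_rw [Finset.sum_comm (s := (Finset.univ : Finset (Fin k)))
        (t := (Finset.univ : Finset (Fin r)))]
  rw [h3]
  exact Finset.sum_nonneg fun c _ => add_nonneg (h2 _) (h2 _)

open scoped Matrix.Norms.Elementwise

theorem NakanoAt.exp_neg_smul {U : Set E} (hU : IsOpen U) {ψ : E → ℝ}
    (hψ : ConvexOn ℝ U ψ) (hψc : ContDiffOn ℝ 2 ψ U) {p : E} (hp : p ∈ U)
    {g : E → Matrix (Fin r) (Fin r) ℂ} (hg : NakanoAt g p) (hc : ContDiffAt ℝ 2 g p)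
    (hpos : ∀ᶠ q in 𝓝 p, (g q).PosDef) :
    NakanoAt (fun q => Real.exp (-ψ q) • g q) p := by
  intro k e u
  have hψp := hψc.contDiffAt (hU.mem_nhds hp)
  have hg1 := hc.differentiableAt (by norm_num)
  have hψ1 := hψp.differentiableAt (by norm_num)
  have hP := hpos.self_of_nhds
  set ρ := Real.exp (-ψ p) with hρ
  have hρ0 : 0 < ρ := Real.exp_pos _
  set w : Fin r → ℂ := ∑ i, fderiv ℝ ψ p (e i) • u i with hw
  set v := jetOne g p e u with hv
  set S : ℂ := ∑ i, ∑ j, fderiv ℝ (fderiv ℝ ψ) p (e i) (e j) • (star (u j) ⬝ᵥ g p *ᵥ u i) with hS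
  have hS0 : 0 ≤ S.re := sum_smul_star_dotProduct_nonneg _ (fun x => by
    rw [← fderiv_fderiv_apply hψp]
    exact hψ.fderiv_fderiv_nonneg hU hψc hp x) hP.posSemidef e u
  have hD1 : ∀ i, fderiv ℝ (fun q => Real.exp (-ψ q) • g q) p (e i) =
      ρ • (fderiv ℝ g p (e i) - fderiv ℝ ψ p (e i) • g p) := fun i =>
    _root_.fderiv_exp_neg_smul hg1 hψ1 (e i)
  have hD2 : ∀ i j, fderiv ℝ (fun q => fderiv ℝ (fun q => Real.exp (-ψ q) • g q) q (e i)) p (e j) =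
      ρ • (fderiv ℝ (fun q => fderiv ℝ g q (e i)) p (e j)
        - fderiv ℝ (fderiv ℝ ψ) p (e i) (e j) • g p - fderiv ℝ ψ p (e i) • fderiv ℝ g p (e j)
        - fderiv ℝ ψ p (e j) • (fderiv ℝ g p (e i) - fderiv ℝ ψ p (e i) • g p)) := fun i j => by
    rw [← fderiv_fderiv_apply hψp, fderiv_fderiv_apply_comm hψp]
    exact fderiv_fderiv_exp_neg_smul hc hψp (e i) (e j)
  have e1 : jetOne (fun q => Real.exp (-ψ q) • g q) p e u = ρ • (v - g p *ᵥ w) := by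
    simp only [jetOne, hD1, hv, hw, Matrix.smul_mulVec, Matrix.sub_mulVec,
      Matrix.mulVec_sum, Matrix.mulVec_smul, ← Finset.smul_sum, Finset.sum_sub_distrib]
  have hvw : ∑ i, ∑ j, fderiv ℝ ψ p (e i) • (star (u j) ⬝ᵥ fderiv ℝ g p (e j) *ᵥ u i) =
      star v ⬝ᵥ w := by
    simp only [hv, hw, jetOne, star_sum, sum_dotProduct, dotProduct_sum, dotProduct_smul,
      Matrix.star_mulVec, conjTranspose_fderiv hg1 (hpos.mono fun q hq => hq.isHermitian),
      Matrix.dotProduct_mulVec, Finset.smul_sum]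
  have hwv : ∑ i, ∑ j, fderiv ℝ ψ p (e j) • (star (u j) ⬝ᵥ fderiv ℝ g p (e i) *ᵥ u i) =
      star w ⬝ᵥ v := by
    simp only [hv, hw, jetOne, star_sum, sum_dotProduct, dotProduct_sum, star_smul, smul_dotProduct,
      star_trivial]
  have hww : ∑ i, ∑ j, fderiv ℝ ψ p (e j) • fderiv ℝ ψ p (e i) • (star (u j) ⬝ᵥ g p *ᵥ u i) =
      star w ⬝ᵥ g p *ᵥ w := by
    simp only [hw, star_sum, sum_dotProduct, dotProduct_sum, star_smul, smul_dotProduct,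
      Matrix.mulVec_sum, Matrix.mulVec_smul, dotProduct_smul, star_trivial, Finset.smul_sum]
    refine Finset.sum_congr rfl fun i _ => Finset.sum_congr rfl fun j _ => ?_
    rw [smul_comm]
  have e2 : jetTwo (fun q => Real.exp (-ψ q) • g q) p e u =
      ρ • (jetTwo g p e u - S - star v ⬝ᵥ w - (star w ⬝ᵥ v - star w ⬝ᵥ g p *ᵥ w)) := by
    simp only [jetTwo, hD2, hS, ← hvw, ← hwv, ← hww, Matrix.smul_mulVec, Matrix.sub_mulVec,
      dotProduct_smul, dotProduct_sub, smul_sub, Finset.sum_sub_distrib, Finset.smul_sum]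
  have hu := (Matrix.isUnit_iff_isUnit_det _).1 hP.isUnit
  have hi : (ρ • g p)⁻¹ = ρ⁻¹ • (g p)⁻¹ := by
    refine Matrix.inv_eq_left_inv ?_
    rw [Matrix.smul_mul, Matrix.mul_smul, smul_smul, Matrix.nonsing_inv_mul _ hu,
      inv_mul_cancel₀ hρ0.ne', one_smul]
  have h0 := hg k e u
  have e3 : star (v - g p *ᵥ w) ⬝ᵥ (g p)⁻¹ *ᵥ (v - g p *ᵥ w) =
      star v ⬝ᵥ (g p)⁻¹ *ᵥ v - star v ⬝ᵥ w - star w ⬝ᵥ v + star w ⬝ᵥ g p *ᵥ w := by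
    have : star w ⬝ᵥ v = star (g p *ᵥ w) ⬝ᵥ (g p)⁻¹ *ᵥ v := by
      rw [Matrix.star_mulVec, hP.isHermitian.eq, ← Matrix.dotProduct_mulVec, Matrix.mulVec_mulVec,
        Matrix.mul_nonsing_inv _ hu, Matrix.one_mulVec]
    rw [Matrix.mulVec_sub, star_sub, sub_dotProduct, dotProduct_sub, dotProduct_sub,
      star_dotProduct_inv_mulVec hP, this, Matrix.mulVec_mulVec, Matrix.nonsing_inv_mul _ hu,
      Matrix.one_mulVec]
    ring
  have key : nakanoValue (ρ • g p) (ρ • (v - g p *ᵥ w))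
      (ρ • (jetTwo g p e u - S - star v ⬝ᵥ w - (star w ⬝ᵥ v - star w ⬝ᵥ g p *ᵥ w))) =
      ρ * (nakanoValue (g p) v (jetTwo g p e u) + S.re) := by
    rw [nakanoValue, hi, Matrix.smul_mulVec, Matrix.mulVec_smul, star_smul, smul_dotProduct,
      dotProduct_smul, dotProduct_smul, smul_smul, smul_smul, star_trivial, e3, nakanoValue]
    rw [show ρ * ρ⁻¹ * ρ = ρ by field_simp, ← smul_sub, Complex.smul_re, smul_eq_mul,
      ← Complex.add_re]
    congr 2
    ring
  rw [e1, e2]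
  show 0 ≤ nakanoValue (ρ • g p) _ _
  rw [key]
  exact mul_nonneg hρ0.le (add_nonneg h0 hS0)

end Weights

section ParametricIntegral

variable {E F X : Type} [NormedAddCommGroup E] [NormedSpace ℝ E] [NormedAddCommGroup F]
  [NormedSpace ℝ F] [CompleteSpace F] [NormedAddCommGroup X] [NormedSpace ℝ X] [MeasureSpace X]
  [BorelSpace X] [SecondCountableTopology X] [IsFiniteMeasureOnCompacts (volume : Measure X)]

omit [NormedSpace ℝ E] [NormedSpace ℝ F] [CompleteSpace F] [NormedSpace ℝ X]
  [SecondCountableTopology X] in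
theorem HasCompactSupport.exists_integrable_bound_prod {f : E × X → F} (hf : Continuous f)
    (hc : HasCompactSupport f) :
    ∃ bound : X → ℝ, Integrable bound ∧ ∀ t x, ‖f (t, x)‖ ≤ bound x := by
  obtain ⟨C, hC⟩ := hf.bounded_above_of_compact_support hc
  have hK : IsCompact (Prod.snd '' tsupport f) := hc.isCompact.image continuous_snd
  refine ⟨(Prod.snd '' tsupport f).indicator fun _ => C, ?_, fun t x => ?_⟩
  · exact (integrable_indicator_iff hK.measurableSet).2
      (integrableOn_const hK.measure_lt_top.ne)
  · by_cases hx : x ∈ Prod.snd '' tsupport f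
    · rw [Set.indicator_of_mem hx]
      exact hC _
    · rw [Set.indicator_of_notMem hx,
        image_eq_zero_of_notMem_tsupport (f := f) fun h => hx ⟨_, h, rfl⟩, norm_zero]

omit [NormedSpace ℝ E] [NormedSpace ℝ F] [CompleteSpace F] [NormedSpace ℝ X] in
theorem integrable_fiber_of_hasCompactSupport {f : E × X → F} (hf : Continuous f)
    (hc : HasCompactSupport f) (t : E) : Integrable fun x => f (t, x) := by
  obtain ⟨bound, hb, hfb⟩ := hc.exists_integrable_bound_prod hf
  exact hb.mono' (hf.comp (by fun_prop)).aestronglyMeasurable (.of_forall fun x => hfb t x)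

omit [NormedSpace ℝ E] [CompleteSpace F] [NormedSpace ℝ X] in
theorem continuous_integral_fiber {f : E × X → F} (hf : Continuous f)
    (hc : HasCompactSupport f) : Continuous fun t => ∫ x, f (t, x) := by
  obtain ⟨bound, hb, hfb⟩ := hc.exists_integrable_bound_prod hf
  exact continuous_of_dominated (fun t => (hf.comp (by fun_prop)).aestronglyMeasurable)
    (fun t => .of_forall fun x => hfb t x) hb (.of_forall fun x => hf.comp (by fun_prop))

omit [CompleteSpace F] [MeasureSpace X] [BorelSpace X] [SecondCountableTopology X]
  [IsFiniteMeasureOnCompacts (volume : Measure X)] in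
theorem HasCompactSupport.fderiv_comp_inl {f : E × X → F} (hc : HasCompactSupport f) :
    HasCompactSupport fun p => (fderiv ℝ f p).comp (ContinuousLinearMap.inl ℝ E X) :=
  (hc.fderiv ℝ).comp_left (g := fun L : E × X →L[ℝ] F => L.comp (ContinuousLinearMap.inl ℝ E X))
    (by simp)

omit [CompleteSpace F] in
theorem hasFDerivAt_integral_fiber {f : E × X → F} (hf : ContDiff ℝ 1 f)
    (hc : HasCompactSupport f) (t : E) :
    HasFDerivAt (fun t => ∫ x, f (t, x))
      (∫ x, (fderiv ℝ f (t, x)).comp (ContinuousLinearMap.inl ℝ E X)) t := by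
  have hf' : Continuous fun p => (fderiv ℝ f p).comp (ContinuousLinearMap.inl ℝ E X) :=
    (hf.continuous_fderiv (by norm_num)).clm_comp continuous_const
  obtain ⟨bound, hb, hfb⟩ := hc.fderiv_comp_inl.exists_integrable_bound_prod hf'
  refine hasFDerivAt_integral_of_dominated_of_fderiv_le (F' := fun t x =>
      (fderiv ℝ f (t, x)).comp (ContinuousLinearMap.inl ℝ E X)) (s := Set.univ) Filter.univ_mem
    (.of_forall fun t => (hf.continuous.comp (by fun_prop)).aestronglyMeasurable)
    (integrable_fiber_of_hasCompactSupport hf.continuous hc t)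
    (hf'.comp (by fun_prop)).aestronglyMeasurable
    (.of_forall fun x t _ => hfb t x) hb (.of_forall fun x t _ => ?_)
  have h1 : HasFDerivAt (fun t : E => (t, x)) (ContinuousLinearMap.inl ℝ E X) t :=
    hasFDerivAt_prodMk_left t x
  exact ((hf.differentiable (by norm_num)) (t, x)).hasFDerivAt.comp t h1

theorem contDiff_integral_fiber (n : ℕ) {F : Type} [NormedAddCommGroup F]
    [NormedSpace ℝ F] [CompleteSpace F] {f : E × X → F} (hf : ContDiff ℝ n f)
    (hc : HasCompactSupport f) : ContDiff ℝ n fun t => ∫ x, f (t, x) := by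
  induction n generalizing F with
  | zero => exact contDiff_zero.2 (continuous_integral_fiber hf.continuous hc)
  | succ n ih =>
    have h1 : ContDiff ℝ 1 f := hf.of_le (by simp)
    have hd := fun t => hasFDerivAt_integral_fiber h1 hc t
    push_cast at hf ⊢
    refine contDiff_succ_iff_fderiv.2 ⟨fun t => (hd t).differentiableAt, by simp, ?_⟩
    rw [show fderiv ℝ (fun t => ∫ x, f (t, x)) = _ from funext fun t => (hd t).fderiv]
    exact ih ((hf.fderiv_right le_rfl).clm_comp contDiff_const) hc.fderiv_comp_inl

omit [CompleteSpace F] in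
theorem fderiv_integral_fiber {f : E × X → F} (hf : ContDiff ℝ 1 f)
    (hc : HasCompactSupport f) (t e : E) :
    fderiv ℝ (fun t => ∫ x, f (t, x)) t e = ∫ x, fderiv ℝ f (t, x) (e, 0) := by
  rw [(hasFDerivAt_integral_fiber hf hc t).fderiv, ContinuousLinearMap.integral_apply]
  · simp
  · exact integrable_fiber_of_hasCompactSupport
      ((hf.continuous_fderiv (by norm_num)).clm_comp continuous_const) hc.fderiv_comp_inl t

variable {G : Type} [NormedAddCommGroup G] [NormedSpace ℝ G] [CompleteSpace G] (L : F →L[ℝ] G)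

omit [CompleteSpace F] [CompleteSpace G] in
theorem integrable_clm_fderiv_fiber {f : E × X → F} (hf : ContDiff ℝ 1 f)
    (hc : HasCompactSupport f) (t e : E) : Integrable fun x => L (fderiv ℝ f (t, x) (e, 0)) :=
  L.integrable_comp (integrable_fiber_of_hasCompactSupport
    ((hf.continuous_fderiv (by norm_num)).clm_apply continuous_const) (hc.fderiv_apply ℝ _) t)

theorem clm_fderiv_integral_fiber {f : E × X → F} (hf : ContDiff ℝ 1 f)
    (hc : HasCompactSupport f) (t e : E) :
    L (fderiv ℝ (fun t => ∫ x, f (t, x)) t e) = ∫ x, L (fderiv ℝ f (t, x) (e, 0)) := by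
  rw [fderiv_integral_fiber hf hc, L.integral_comp_comm]
  exact integrable_fiber_of_hasCompactSupport
    ((hf.continuous_fderiv (by norm_num)).clm_apply continuous_const) (hc.fderiv_apply ℝ _) t

omit [CompleteSpace F] [CompleteSpace G] in
theorem integrable_clm_fderiv_fderiv_fiber {f : E × X → F} (hf : ContDiff ℝ 2 f)
    (hc : HasCompactSupport f) (t e e' : E) :
    Integrable fun x => L (fderiv ℝ (fun p => fderiv ℝ f p (e, 0)) (t, x) (e', 0)) :=
  integrable_clm_fderiv_fiber L ((hf.fderiv_right (m := 1) (by norm_num)).clm_apply contDiff_const)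
    (hc.fderiv_apply ℝ _) t e'

theorem clm_fderiv_fderiv_integral_fiber {f : E × X → F} (hf : ContDiff ℝ 2 f)
    (hc : HasCompactSupport f) (t e e' : E) :
    L (fderiv ℝ (fun q => fderiv ℝ (fun t => ∫ x, f (t, x)) q e) t e') =
      ∫ x, L (fderiv ℝ (fun p => fderiv ℝ f p (e, 0)) (t, x) (e', 0)) := by
  rw [show (fun q => fderiv ℝ (fun t => ∫ x, f (t, x)) q e) = _ from
    funext fun q => fderiv_integral_fiber (hf.of_le (by norm_num)) hc q e]
  exact clm_fderiv_integral_fiber L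
    ((hf.fderiv_right (m := 1) (by norm_num)).clm_apply contDiff_const) (hc.fderiv_apply ℝ _) t e'

open scoped Matrix Matrix.Norms.Elementwise

theorem jetOne_integral_fiber {r : ℕ} {g : E × X → Matrix (Fin r) (Fin r) ℂ}
    (hg : ContDiff ℝ 2 g) (hc : HasCompactSupport g) (t : E) {k : ℕ} (e : Fin k → E)
    (u : Fin k → Fin r → ℂ) :
    jetOne (fun t => ∫ x, g (t, x)) t e u = ∫ x, jetOne g (t, x) (fun i => (e i, 0)) u := by
  have h1 : ContDiff ℝ 1 g := hg.of_le (by norm_num)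
  have hI : ∀ i, Integrable fun x => fderiv ℝ g (t, x) (e i, 0) *ᵥ u i := fun i =>
    integrable_clm_fderiv_fiber (mulVecCLM (u i)) h1 hc t (e i)
  simp only [jetOne]
  rw [integral_finsetSum _ fun i _ => hI i]
  exact Finset.sum_congr rfl fun i _ => clm_fderiv_integral_fiber (mulVecCLM (u i)) h1 hc t (e i)

theorem jetTwo_integral_fiber {r : ℕ} {g : E × X → Matrix (Fin r) (Fin r) ℂ}
    (hg : ContDiff ℝ 2 g) (hc : HasCompactSupport g) (t : E) {k : ℕ} (e : Fin k → E)
    (u : Fin k → Fin r → ℂ) :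
    jetTwo (fun t => ∫ x, g (t, x)) t e u = ∫ x, jetTwo g (t, x) (fun i => (e i, 0)) u := by
  have hI : ∀ i j, Integrable fun x =>
      star (u j) ⬝ᵥ fderiv ℝ (fun q => fderiv ℝ g q (e i, 0)) (t, x) (e j, 0) *ᵥ u i :=
    fun i j => integrable_clm_fderiv_fderiv_fiber
    ((starDotCLM (u j)).comp (mulVecCLM (u i))) hg hc t (e i) (e j)
  simp only [jetTwo]
  rw [integral_finsetSum _ fun i _ => integrable_finsetSum _ fun j _ => hI i j]
  refine Finset.sum_congr rfl fun i _ => ?_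
  rw [integral_finsetSum _ fun j _ => hI i j]
  exact Finset.sum_congr rfl fun j _ => clm_fderiv_fderiv_integral_fiber
    ((starDotCLM (u j)).comp (mulVecCLM (u i))) hg hc t (e i) (e j)

end ParametricIntegral

section LineIntegral

open scoped Matrix Matrix.Norms.Elementwise Topology

variable {r : ℕ}

theorem Matrix.IsHermitian.im_star_dotProduct_mulVec {A : Matrix (Fin r) (Fin r) ℂ}
    (hA : A.IsHermitian) (v : Fin r → ℂ) : (star v ⬝ᵥ A *ᵥ v).im = 0 := by
  have h := star_star_dotProduct_mulVec A v v
  rw [hA.eq] at h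
  exact Complex.conj_eq_iff_im.1 h

theorem Matrix.IsHermitian.posDef_of_re_pos {A : Matrix (Fin r) (Fin r) ℂ}
    (hA : A.IsHermitian) (h : ∀ v : Fin r → ℂ, v ≠ 0 → 0 < (star v ⬝ᵥ A *ᵥ v).re) : A.PosDef :=
  Matrix.PosDef.of_dotProduct_mulVec_pos hA fun v hv =>
    Complex.pos_iff.2 ⟨h v hv, (hA.im_star_dotProduct_mulVec v).symm⟩

theorem Matrix.PosDef.re_pos {A : Matrix (Fin r) (Fin r) ℂ} (hA : A.PosDef) {v : Fin r → ℂ}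
    (hv : v ≠ 0) : 0 < (star v ⬝ᵥ A *ᵥ v).re :=
  (Complex.pos_iff.1 (hA.dotProduct_mulVec_pos hv)).1

/-- `A ↦ re (v* A v)` as a continuous real-linear map. -/
def reFormCLM (v : Fin r → ℂ) : Matrix (Fin r) (Fin r) ℂ →L[ℝ] ℝ :=
  Complex.reCLM.comp ((starDotCLM v).comp (mulVecCLM v))

@[simp]
theorem reFormCLM_apply (v : Fin r → ℂ) (A : Matrix (Fin r) (Fin r) ℂ) :
    reFormCLM v A = (star v ⬝ᵥ A *ᵥ v).re := rfl

theorem posDef_intervalIntegral {A : ℝ → Matrix (Fin r) (Fin r) ℂ} {a b : ℝ} (hab : a < b)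
    (hA : Continuous A) (hherm : ∀ x, (A x).IsHermitian)
    (hpos : ∀ x ∈ Set.Ioo a b, (A x).PosDef) : (∫ x in a..b, A x).PosDef := by
  refine Matrix.IsHermitian.posDef_of_re_pos ?_ fun v hv => ?_
  · have h := (conjTransposeCLM r).intervalIntegral_comp_comm (hA.intervalIntegrable a b (μ := volume))
    calc (∫ x in a..b, A x).conjTranspose = ∫ x in a..b, (A x).conjTranspose := h.symm
      _ = ∫ x in a..b, A x := by simp only [(hherm _).eq]
  · have h := (reFormCLM v).intervalIntegral_comp_comm (hA.intervalIntegrable a b (μ := volume))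
    refine lt_of_lt_of_eq ?_ h
    refine intervalIntegral.intervalIntegral_pos_of_pos_on
      (((reFormCLM v).continuous.comp hA).intervalIntegrable a b) (fun x hx => ?_) hab
    exact (hpos x hx).re_pos hv

theorem continuousAt_inv_of_isUnit {A : Matrix (Fin r) (Fin r) ℂ} (hA : IsUnit A) :
    ContinuousAt (fun B : Matrix (Fin r) (Fin r) ℂ => B⁻¹) A := by
  obtain ⟨L, hL, -⟩ := exists_hasFDerivAt_inv (hasFDerivAt_id (𝕜 := ℝ) A) hA
  exact hL.continuousAt

theorem tendsto_nakanoValue {ι : Type*} {l : Filter ι}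
    {A : ι → Matrix (Fin r) (Fin r) ℂ} {v : ι → Fin r → ℂ} {H : ι → ℂ}
    {A₀ : Matrix (Fin r) (Fin r) ℂ} {v₀ : Fin r → ℂ} {H₀ : ℂ} (hA : Filter.Tendsto A l (𝓝 A₀))
    (hv : Filter.Tendsto v l (𝓝 v₀)) (hH : Filter.Tendsto H l (𝓝 H₀)) (hu : IsUnit A₀) :
    Filter.Tendsto (fun i => nakanoValue (A i) (v i) (H i)) l
      (𝓝 (nakanoValue A₀ v₀ H₀)) := by
  have hi : Filter.Tendsto (fun i => (A i)⁻¹) l (𝓝 A₀⁻¹) := (continuousAt_inv_of_isUnit hu).tendsto.comp hA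
  have h : Filter.Tendsto (fun i => star (v i) ⬝ᵥ (A i)⁻¹ *ᵥ v i) l (𝓝 (star v₀ ⬝ᵥ A₀⁻¹ *ᵥ v₀)) := by
    simp only [dotProduct, Matrix.mulVec]
    refine tendsto_finsetSum _ fun a _ => Filter.Tendsto.mul ?_ (tendsto_finsetSum _ fun b _ =>
      Filter.Tendsto.mul ?_ ?_)
    · exact (tendsto_pi_nhds.1 hv a).star
    · exact tendsto_pi_nhds.1 (tendsto_pi_nhds.1 hi a) b
    · exact tendsto_pi_nhds.1 hv b
  exact (Complex.continuous_re.tendsto _).comp (h.sub hH)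

theorem continuous_intervalIntegral_shrink {F : Type*} [NormedAddCommGroup F] [NormedSpace ℝ F]
    [CompleteSpace F] {f : ℝ → F} (hf : Continuous f) (a b : ℝ) :
    Continuous fun δ : ℝ => ∫ x in (a + δ)..(b - δ), f x := by
  have h1 : Continuous fun s : ℝ => ∫ x in (0 : ℝ)..s, f x :=
    continuous_iff_continuousAt.2 fun s =>
      ((hf.integral_hasStrictDerivAt 0 s).hasDerivAt).continuousAt
  have h2 : (fun δ : ℝ => ∫ x in (a + δ)..(b - δ), f x) = fun δ =>
      (∫ x in (0 : ℝ)..(b - δ), f x) - ∫ x in (0 : ℝ)..(a + δ), f x := funext fun δ =>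
    (intervalIntegral.integral_interval_sub_left (hf.intervalIntegrable _ _)
      (hf.intervalIntegrable _ _)).symm
  rw [h2]
  exact (h1.comp (by fun_prop)).sub (h1.comp (by fun_prop))

theorem nakanoValue_eq_of_re_eq {A : Matrix (Fin r) (Fin r) ℂ} {v : Fin r → ℂ} {H H' : ℂ}
    (h : H.re = H'.re) : nakanoValue A v H = nakanoValue A v H' := by
  simp only [nakanoValue, Complex.sub_re, h]

end LineIntegral

section NakanoClass

open scoped Matrix Matrix.Norms.Elementwise Topology

variable {E : Type*} [NormedAddCommGroup E] [NormedSpace ℝ E] {r : ℕ}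

/-- Compactly supported `C²` matrix functions that are positive definite and Nakano semi-positive
on a bounded convex open set and vanish outside of it. -/
structure IsNakanoBump (U : Set E) (g : E → Matrix (Fin r) (Fin r) ℂ) : Prop where
  isOpen : IsOpen U
  convex : Convex ℝ U
  isBounded : Bornology.IsBounded U
  contDiff : ContDiff ℝ 2 g
  hasCompactSupport : HasCompactSupport g
  posDef : ∀ p ∈ U, (g p).PosDef
  eq_zero : ∀ p ∉ U, g p = 0
  nakanoAt : ∀ p ∈ U, NakanoAt g p

namespace IsNakanoBump

variable {U : Set E} {g : E → Matrix (Fin r) (Fin r) ℂ}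

theorem isHermitian (h : IsNakanoBump U g) (p : E) : (g p).IsHermitian := by
  by_cases hp : p ∈ U
  · exact (h.posDef p hp).isHermitian
  · rw [h.eq_zero p hp]
    exact Matrix.isHermitian_zero

theorem comp_equiv (h : IsNakanoBump U g) {F : Type*} [NormedAddCommGroup F] [NormedSpace ℝ F]
    (L : F ≃L[ℝ] E) : IsNakanoBump (L ⁻¹' U) (fun q => g (L q)) where
  isOpen := h.isOpen.preimage L.continuous
  convex := h.convex.linear_preimage L.toLinearEquiv.toLinearMap
  isBounded := by
    rw [← L.image_symm_eq_preimage]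
    exact (L.symm : E →L[ℝ] F).lipschitz.isBounded_image h.isBounded
  contDiff := h.contDiff.comp L.contDiff
  hasCompactSupport := h.hasCompactSupport.comp_homeomorph L.toHomeomorph
  posDef := fun p hp => h.posDef _ hp
  eq_zero := fun p hp => h.eq_zero _ hp
  nakanoAt := fun p hp => (h.nakanoAt _ hp).comp_continuousLinearMap (L : F →L[ℝ] E)
    h.contDiff.contDiffAt

end IsNakanoBump

end NakanoClass

section FiberIntegration

open scoped Matrix Matrix.Norms.Elementwise Topology

theorem exists_eq_Ioo_of_isOpen_convex {S : Set ℝ} (ho : IsOpen S) (hc : Convex ℝ S)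
    (hb : Bornology.IsBounded S) (hne : S.Nonempty) : ∃ a b, a < b ∧ S = Set.Ioo a b := by
  have h1 : S ⊆ Set.Icc (sInf S) (sSup S) := fun x hx =>
    ⟨csInf_le hb.bddBelow hx, le_csSup hb.bddAbove hx⟩
  have h2 : S ⊆ Set.Ioo (sInf S) (sSup S) := by
    rw [← interior_Icc]
    exact ho.subset_interior_iff.2 h1
  have h3 : S = Set.Ioo (sInf S) (sSup S) :=
    h2.antisymm (IsConnected.Ioo_csInf_csSup_subset ⟨hne, hc.isPreconnected⟩ hb.bddBelow hb.bddAbove)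
  obtain ⟨x, hx⟩ := hne
  exact ⟨_, _, (h2 hx).1.trans (h2 hx).2, h3⟩

theorem integral_eq_intervalIntegral_of_eq_zero {F : Type*} [NormedAddCommGroup F]
    [NormedSpace ℝ F] {f : ℝ → F} {a b : ℝ} (hab : a ≤ b) (h : ∀ x ∉ Set.Icc a b, f x = 0) :
    ∫ x, f x = ∫ x in a..b, f x := by
  rw [intervalIntegral.integral_of_le hab, ← integral_Icc_eq_integral_Ioc,
    setIntegral_eq_integral_of_forall_compl_eq_zero h]

variable {E : Type} [NormedAddCommGroup E] [NormedSpace ℝ E] {r : ℕ}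

theorem notMem_closure_of_fiber_eq_Ioo {U : Set (E × ℝ)} (ho : IsOpen U) (hc : Convex ℝ U) {t : E}
    {a b : ℝ} (hab : a < b) (h : ∀ x, (t, x) ∈ U ↔ x ∈ Set.Ioo a b) {x : ℝ}
    (hx : x ∉ Set.Icc a b) : (t, x) ∉ closure U := by
  intro hcl
  have hmid : (a + b) / 2 ∈ Set.Ioo a b := ⟨by linarith, by linarith⟩
  have key : ∀ c ∈ openSegment ℝ ((a + b) / 2) x, c ∈ Set.Ioo a b := by
    rintro c ⟨α, β, hα, hβ, hαβ, rfl⟩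
    rw [← h]
    have h1 := hc.openSegment_interior_closure_subset_interior
      (x := (t, (a + b) / 2)) (by rw [ho.interior_eq]; exact (h _).2 hmid) hcl
    rw [ho.interior_eq] at h1
    refine h1 ⟨α, β, hα, hβ, hαβ, ?_⟩
    simp [← add_smul, hαβ]
  rcases lt_or_ge x a with h1 | h1
  · have := key a (by
      rw [openSegment_symm, openSegment_eq_Ioo (h1.trans hmid.1)]
      exact ⟨h1, hmid.1⟩)
    exact lt_irrefl _ this.1
  · have h2 : b < x := not_le.1 fun h2 => hx ⟨h1, h2⟩
    have := key b (by
      rw [openSegment_eq_Ioo (hmid.2.trans h2)]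
      exact ⟨hmid.2, h2⟩)
    exact lt_irrefl _ this.2

theorem hasDerivAt_fiber {F : Type*} [NormedAddCommGroup F] [NormedSpace ℝ F] {f : E × ℝ → F}
    {t : E} {x : ℝ} (hf : DifferentiableAt ℝ f (t, x)) :
    HasDerivAt (fun x => f (t, x)) (fderiv ℝ f (t, x) (0, 1)) x :=
  hf.hasFDerivAt.comp_hasDerivAt x ((hasDerivAt_const x t).prodMk (hasDerivAt_id x))

theorem ContDiff.jetTwo_continuous {F : Type*} [NormedAddCommGroup F] [NormedSpace ℝ F]
    {g : F → Matrix (Fin r) (Fin r) ℂ}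
    (hg : ContDiff ℝ 2 g) {k : ℕ} (e : Fin k → F) (u : Fin k → Fin r → ℂ) :
    Continuous fun p => jetTwo g p e u := by
  refine continuous_finsetSum _ fun i _ => continuous_finsetSum _ fun j _ => ?_
  have h1 : ContDiff ℝ 1 fun q => fderiv ℝ g q (e i) :=
    (hg.fderiv_right (m := 1) (by norm_num)).clm_apply contDiff_const
  have h2 : Continuous fun q => fderiv ℝ (fun q => fderiv ℝ g q (e i)) q (e j) :=
    (h1.continuous_fderiv (by norm_num)).clm_apply continuous_const
  exact ((starDotCLM (u j)).comp (mulVecCLM (u i))).continuous.comp h2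

/-- The Nakano form in one extra direction, split off from the others. -/
theorem nakanoValue_cons {F : Type*} [NormedAddCommGroup F] [NormedSpace ℝ F]
    {g : F → Matrix (Fin r) (Fin r) ℂ} (hg : ContDiff ℝ 2 g) (hherm : ∀ q, (g q).IsHermitian)
    {p : F} {k : ℕ} (d : F) (e : Fin k → F) (y : Fin r → ℂ) (u : Fin k → Fin r → ℂ) :
    nakanoValue (g p) (jetOne g p (Fin.cons d e : Fin (k + 1) → F) (Fin.cons y u : Fin (k + 1) → Fin r → ℂ))
      (jetTwo g p (Fin.cons d e : Fin (k + 1) → F) (Fin.cons y u : Fin (k + 1) → Fin r → ℂ)) =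
    nakanoValue (g p) (jetOne g p e u + fderiv ℝ g p d *ᵥ y)
      (jetTwo g p e u + 2 * (star y ⬝ᵥ
        ∑ i, fderiv ℝ (fun q => fderiv ℝ g q (e i)) p d *ᵥ u i) +
        star y ⬝ᵥ fderiv ℝ (fun q => fderiv ℝ g q d) p d *ᵥ y) := by
  have h1 : jetOne g p (Fin.cons d e : Fin (k + 1) → F)
      (Fin.cons y u : Fin (k + 1) → Fin r → ℂ) = jetOne g p e u + fderiv ℝ g p d *ᵥ y := by
    simp only [jetOne, Fin.sum_univ_succ, Fin.cons_zero, Fin.cons_succ]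
    exact add_comm _ _
  rw [h1]
  refine nakanoValue_eq_of_re_eq ?_
  have hsymm : ∀ i, (star (u i) ⬝ᵥ fderiv ℝ (fun q => fderiv ℝ g q d) p (e i) *ᵥ y).re =
      (star y ⬝ᵥ fderiv ℝ (fun q => fderiv ℝ g q (e i)) p d *ᵥ u i).re := fun i => by
    have hd : DifferentiableAt ℝ (fun q => fderiv ℝ g q (e i)) p :=
      hg.contDiffAt.differentiableAt_fderiv_apply (e i)
    have h2 : (fderiv ℝ (fun q => fderiv ℝ g q (e i)) p d).conjTranspose =
        fderiv ℝ (fun q => fderiv ℝ g q (e i)) p d :=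
      conjTranspose_fderiv hd (.of_forall fun q =>
        conjTranspose_fderiv (hg.differentiable (by norm_num) q) (.of_forall hherm) (e i)) d
    have h3 := star_star_dotProduct_mulVec (fderiv ℝ (fun q => fderiv ℝ g q (e i)) p d) (u i) y
    rw [h2] at h3
    rw [show fderiv ℝ (fun q => fderiv ℝ g q d) p (e i) =
      fderiv ℝ (fun q => fderiv ℝ g q (e i)) p d from
      fderiv_fderiv_apply_comm hg.contDiffAt _ _]
    rw [← h3]
    exact Complex.conj_re _
  simp only [jetTwo, Fin.sum_univ_succ, Fin.cons_zero, Fin.cons_succ, dotProduct_sum,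
    Finset.sum_add_distrib, Complex.add_re, Complex.re_sum, hsymm, Complex.mul_re, Complex.re_ofNat,
    Complex.im_ofNat]
  ring

end FiberIntegration

section FiberStep

open scoped Matrix Matrix.Norms.Elementwise Topology

variable {E : Type} [NormedAddCommGroup E] [NormedSpace ℝ E] {r : ℕ}

theorem jetOne_zero {F : Type*} [NormedAddCommGroup F] [NormedSpace ℝ F] (p : F) {k : ℕ}
    (e : Fin k → F) (u : Fin k → Fin r → ℂ) :
    jetOne (fun _ : F => (0 : Matrix (Fin r) (Fin r) ℂ)) p e u = 0 := by
  simp [jetOne]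

theorem jetTwo_zero {F : Type*} [NormedAddCommGroup F] [NormedSpace ℝ F] (p : F) {k : ℕ}
    (e : Fin k → F) (u : Fin k → Fin r → ℂ) :
    jetTwo (fun _ : F => (0 : Matrix (Fin r) (Fin r) ℂ)) p e u = 0 := by
  simp [jetTwo]

namespace IsNakanoBump

theorem eventuallyEq_zero {F : Type*} [NormedAddCommGroup F] [NormedSpace ℝ F] {U : Set F}
    {g : F → Matrix (Fin r) (Fin r) ℂ} (hg : IsNakanoBump U g) {p : F} (hp : p ∉ closure U) :
    g =ᶠ[𝓝 p] fun _ => 0 := by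
  filter_upwards [isClosed_closure.isOpen_compl.mem_nhds hp] with q hq
  exact hg.eq_zero q fun h => hq (subset_closure h)

variable {U : Set (E × ℝ)} {g : E × ℝ → Matrix (Fin r) (Fin r) ℂ}

theorem exists_fiber_eq_Ioo (hg : IsNakanoBump U g) {t : E} (ht : t ∈ Prod.fst '' U) :
    ∃ a b, a < b ∧ ∀ x, (t, x) ∈ U ↔ x ∈ Set.Ioo a b := by
  obtain ⟨⟨t, x₀⟩, hx₀, rfl⟩ := ht
  have hc : Convex ℝ ((fun x : ℝ => (t, x)) ⁻¹' U) := by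
    intro x hx y hy α β hα hβ hαβ
    have := hg.convex hx hy hα hβ hαβ
    rwa [Prod.smul_mk, Prod.smul_mk, Prod.mk_add_mk, ← add_smul, hαβ, one_smul] at this
  have hb : Bornology.IsBounded ((fun x : ℝ => (t, x)) ⁻¹' U) :=
    (LipschitzWith.prod_snd.isBounded_image hg.isBounded).subset fun x hx => ⟨(t, x), hx, rfl⟩
  obtain ⟨a, b, hab, h⟩ := exists_eq_Ioo_of_isOpen_convex
    (hg.isOpen.preimage (by fun_prop)) hc hb ⟨x₀, hx₀⟩
  exact ⟨a, b, hab, fun x => Set.ext_iff.1 h x⟩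

theorem nakanoValue_nonneg_of_fiber (hg : IsNakanoBump U g) {t : E} {a b : ℝ} (hab : a < b)
    (h : ∀ x ∈ Set.Icc a b, (t, x) ∈ U) {k : ℕ} (e : Fin k → E) (u : Fin k → Fin r → ℂ) :
    0 ≤ nakanoValue (∫ x in a..b, g (t, x)) (∫ x in a..b, jetOne g (t, x) (fun i => (e i, 0)) u)
      (∫ x in a..b, jetTwo g (t, x) (fun i => (e i, 0)) u) := by
  have hd : ∀ (e : E × ℝ) q, DifferentiableAt ℝ (fun q => fderiv ℝ g q e) q := fun e q =>
    hg.contDiff.contDiffAt.differentiableAt_fderiv_apply e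
  refine nakanoValue_intervalIntegral_nonneg hab.le
    (A1 := fun x => fderiv ℝ g (t, x) (0, 1))
    (A2 := fun x => fderiv ℝ (fun q => fderiv ℝ g q (0, 1)) (t, x) (0, 1))
    (h1 := fun x => ∑ i, fderiv ℝ (fun q => fderiv ℝ g q (e i, 0)) (t, x) (0, 1) *ᵥ u i)
    (fun x => hasDerivAt_fiber (hg.contDiff.differentiable (by norm_num) _))
    (fun x => hasDerivAt_fiber (hd _ _)) (fun x => ?_) ?_ (fun x => hg.isHermitian _)
    (fun x hx => hg.posDef _ (h x hx)) (fun x hx y => ?_) ?_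
  · refine HasDerivAt.fun_sum fun i _ => ?_
    exact (mulVecCLM (u i)).hasFDerivAt.comp_hasDerivAt x (hasDerivAt_fiber (hd (e i, 0) (t, x)))
  · exact (hg.contDiff.jetTwo_continuous _ u).comp (by fun_prop)
  · rw [← nakanoValue_cons hg.contDiff hg.isHermitian]
    exact hg.nakanoAt _ (h x hx) _ _ _
  · exact posDef_intervalIntegral hab (hg.contDiff.continuous.comp (by fun_prop))
      (fun x => hg.isHermitian _) fun x hx => hg.posDef _ (h x (Set.Ioo_subset_Icc_self hx))

/-- Integration over a one-dimensional fiber preserves Nakano semi-positivity. -/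
theorem integral_real (hg : IsNakanoBump U g) :
    IsNakanoBump (Prod.fst '' U) (fun t => ∫ x, g (t, x)) where
  isOpen := isOpenMap_fst U hg.isOpen
  convex := hg.convex.linear_image (LinearMap.fst ℝ E ℝ)
  isBounded := LipschitzWith.prod_fst.isBounded_image hg.isBounded
  contDiff := by exact_mod_cast contDiff_integral_fiber 2 hg.contDiff hg.hasCompactSupport
  hasCompactSupport := by
    refine HasCompactSupport.intro (hg.hasCompactSupport.isCompact.image continuous_fst)
      fun t ht => ?_
    have : ∀ x, g (t, x) = 0 := fun x =>
      image_eq_zero_of_notMem_tsupport fun h => ht ⟨_, h, rfl⟩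
    simp [this]
  posDef := by
    intro t ht
    obtain ⟨a, b, hab, h⟩ := hg.exists_fiber_eq_Ioo ht
    rw [integral_eq_intervalIntegral_of_eq_zero hab.le fun x hx =>
      hg.eq_zero _ fun hU => hx (Set.Ioo_subset_Icc_self ((h x).1 hU))]
    exact posDef_intervalIntegral hab (hg.contDiff.continuous.comp (by fun_prop))
      (fun x => hg.isHermitian _) fun x hx => hg.posDef _ ((h x).2 hx)
  eq_zero := by
    intro t ht
    have : ∀ x, g (t, x) = 0 := fun x => hg.eq_zero _ fun h => ht ⟨_, h, rfl⟩
    simp [this]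
  nakanoAt := by
    intro t ht k e u
    obtain ⟨a, b, hab, h⟩ := hg.exists_fiber_eq_Ioo ht
    have hz : ∀ x ∉ Set.Icc a b, g =ᶠ[𝓝 (t, x)] fun _ => 0 := fun x hx =>
      hg.eventuallyEq_zero (notMem_closure_of_fiber_eq_Ioo hg.isOpen hg.convex hab h hx)
    rw [jetOne_integral_fiber hg.contDiff hg.hasCompactSupport,
      jetTwo_integral_fiber hg.contDiff hg.hasCompactSupport]
    change 0 ≤ nakanoValue (∫ x, g (t, x)) _ _
    rw [integral_eq_intervalIntegral_of_eq_zero hab.le fun x hx => (hz x hx).eq_of_nhds,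
      integral_eq_intervalIntegral_of_eq_zero hab.le fun x hx =>
        (jetOne_congr (hz x hx) _ u).trans (jetOne_zero _ _ u),
      integral_eq_intervalIntegral_of_eq_zero hab.le fun x hx =>
        (jetTwo_congr (hz x hx) _ u).trans (jetTwo_zero _ _ u)]
    have cg : Continuous fun x => g (t, x) := hg.contDiff.continuous.comp (by fun_prop)
    have c1 : Continuous fun x => jetOne g (t, x) (fun i => ((e i, 0) : E × ℝ)) u :=
      continuous_finsetSum _ fun i _ => (mulVecCLM (u i)).continuous.comp
        (((hg.contDiff.continuous_fderiv (by norm_num)).clm_apply continuous_const).comp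
          (by fun_prop : Continuous fun x : ℝ => (t, x)))
    have c2 : Continuous fun x => jetTwo g (t, x) (fun i => ((e i, 0) : E × ℝ)) u :=
      (hg.contDiff.jetTwo_continuous _ u).comp (by fun_prop)
    have hP := posDef_intervalIntegral hab cg
      (fun x => hg.isHermitian _) fun x hx => hg.posDef _ ((h x).2 hx)
    have ha : a = a + 0 := (add_zero a).symm
    have lim : ∀ {F : Type} [NormedAddCommGroup F] [NormedSpace ℝ F] [CompleteSpace F] {f : ℝ → F},
        Continuous f → Filter.Tendsto (fun δ : ℝ => ∫ x in (a + δ)..(b - δ), f x) (𝓝[>] 0)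
          (𝓝 (∫ x in a..b, f x)) := fun hf => by
      have := (continuous_intervalIntegral_shrink hf a b).tendsto 0
      rw [add_zero, sub_zero] at this
      exact this.mono_left nhdsWithin_le_nhds
    refine ge_of_tendsto (tendsto_nakanoValue (lim cg) (lim c1) (lim c2) hP.isUnit) ?_
    filter_upwards [Ioo_mem_nhdsGT (half_pos (sub_pos.2 hab))] with δ hδ
    refine hg.nakanoValue_nonneg_of_fiber (by linarith [hδ.2]) (fun x hx => (h x).2 ?_) e u
    exact ⟨by linarith [hδ.1, hx.1], by linarith [hδ.1, hx.2]⟩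

end IsNakanoBump

end FiberStep

section IteratedIntegration

open scoped Matrix Matrix.Norms.Elementwise Topology

theorem integral_pi_fin_succ {F : Type*} [NormedAddCommGroup F] [NormedSpace ℝ F] {k : ℕ}
    {f : (Fin (k + 1) → ℝ) → F} (hf : Continuous f) (hc : HasCompactSupport f) :
    ∫ y, f y = ∫ s : ℝ, ∫ x : Fin k → ℝ, f (Fin.cons s x : Fin (k + 1) → ℝ) := by
  let L := Fin.consEquivL ℝ fun _ : Fin (k + 1) => ℝ
  have hint : Integrable (fun p => f (L p)) (volume.prod volume) :=
    (hf.comp L.continuous).integrable_of_hasCompactSupport (hc.comp_homeomorph L.toHomeomorph)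
  have hmp := (volume_preserving_piFinSuccAbove (fun _ : Fin (k + 1) => ℝ) 0).symm
  have h1 : ∫ p : ℝ × (Fin k → ℝ), f (L p) = ∫ y, f y := by
    rw [← hmp.integral_comp']
    refine integral_congr_ae (.of_forall fun p => congrArg f ?_)
    exact (Fin.insertNth_zero' p.1 p.2).symm
  rw [← h1]
  exact integral_prod _ hint

variable {E : Type} [NormedAddCommGroup E] [NormedSpace ℝ E] {r : ℕ}

/-- Integration over the fibers of a product with `ℝᵏ` preserves Nakano semi-positivity. -/
theorem IsNakanoBump.integral_pi (k : ℕ) {U : Set (E × (Fin k → ℝ))}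
    {g : E × (Fin k → ℝ) → Matrix (Fin r) (Fin r) ℂ} (hg : IsNakanoBump U g) :
    IsNakanoBump (Prod.fst '' U) (fun t => ∫ x, g (t, x)) := by
  induction k generalizing E with
  | zero =>
    have h := hg.comp_equiv (ContinuousLinearEquiv.prodUnique ℝ E (Fin 0 → ℝ)).symm
    convert h using 1
    · ext t
      constructor
      · rintro ⟨⟨t, x⟩, h, rfl⟩
        change (ContinuousLinearEquiv.prodUnique ℝ E (Fin 0 → ℝ)).symm t ∈ U
        rwa [show (ContinuousLinearEquiv.prodUnique ℝ E (Fin 0 → ℝ)).symm t = (t, x) from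
          Prod.ext rfl (Subsingleton.elim _ _)]
      · exact fun h => ⟨_, h, rfl⟩
    · funext t
      rw [Measure.volume_pi_eq_dirac (fun _ => 0), integral_dirac]
      exact congrArg (fun x => g (t, x)) (Subsingleton.elim _ _)
  | succ k ih =>
    let L : ((E × ℝ) × (Fin k → ℝ)) ≃L[ℝ] E × (Fin (k + 1) → ℝ) :=
      (ContinuousLinearEquiv.prodAssoc ℝ E ℝ (Fin k → ℝ)).trans
        ((ContinuousLinearEquiv.refl ℝ E).prodCongr (Fin.consEquivL ℝ fun _ : Fin (k + 1) => ℝ))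
    have h := (ih (hg.comp_equiv L)).integral_real
    convert h using 1
    · ext t
      constructor
      · rintro ⟨⟨t, y⟩, h, rfl⟩
        refine ⟨_, ⟨L.symm (t, y), ?_, rfl⟩, rfl⟩
        change L (L.symm (t, y)) ∈ U
        rwa [L.apply_symm_apply]
      · rintro ⟨_, ⟨p, hp, rfl⟩, rfl⟩
        exact ⟨L p, hp, rfl⟩
    · funext t
      have hc : HasCompactSupport fun y => g (t, y) :=
        .intro (hg.hasCompactSupport.isCompact.image continuous_snd) fun y hy =>
          image_eq_zero_of_notMem_tsupport fun h => hy ⟨_, h, rfl⟩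
      exact integral_pi_fin_succ (hg.contDiff.continuous.comp (by fun_prop)) hc

end IteratedIntegration

section ConcaveExhaustion

open scoped Topology Convolution ContDiff

variable {V : Type*} [NormedAddCommGroup V] [NormedSpace ℝ V]

theorem Convex.convexOn_infDist {K : Set V} (hK : IsCompact K) (hne : K.Nonempty)
    (hc : Convex ℝ K) : ConvexOn ℝ Set.univ fun x => Metric.infDist x K := by
  refine ⟨convex_univ, fun x _ y _ α β hα hβ hαβ => ?_⟩
  obtain ⟨p, hp, hxp⟩ := hK.exists_infDist_eq_dist hne x
  obtain ⟨q, hq, hyq⟩ := hK.exists_infDist_eq_dist hne y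
  calc Metric.infDist (α • x + β • y) K
      ≤ dist (α • x + β • y) (α • p + β • q) :=
        Metric.infDist_le_dist_of_mem (hc hp hq hα hβ hαβ)
    _ ≤ dist (α • x) (α • p) + dist (β • y) (β • q) := dist_add_add_le _ _ _ _
    _ = α • Metric.infDist x K + β • Metric.infDist y K := by
        rw [hxp, hyq, dist_smul₀, dist_smul₀, Real.norm_of_nonneg hα, Real.norm_of_nonneg hβ]
        rfl

/-- Points of a ball whose distance to the complement of a set is bounded below. -/
def innerParallelBody (Ω : Set V) (ρ R : ℝ) : Set V :=
  {y | ∀ z ∉ Ω, ρ ≤ dist y z} ∩ Metric.closedBall 0 R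

omit [NormedSpace ℝ V] in
theorem innerParallelBody_subset (Ω : Set V) {ρ : ℝ} (hρ : 0 < ρ) (R : ℝ) :
    innerParallelBody Ω ρ R ⊆ Ω := fun y hy => by
  by_contra h
  have := hy.1 y h
  rw [dist_self] at this
  exact hρ.not_ge this

theorem Convex.innerParallelBody {Ω : Set V} (hΩ : Convex ℝ Ω) (ρ R : ℝ) :
    Convex ℝ (innerParallelBody Ω ρ R) := by
  refine Convex.inter (fun x hx y hy α β hα hβ hαβ z hz => ?_) (convex_closedBall 0 R)
  by_contra! h
  set w := z - (α • x + β • y) with hw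
  have hlt : ‖w‖ < ρ := by rwa [hw, ← dist_eq_norm, dist_comm]
  have hmem : ∀ v : V, (∀ z ∉ Ω, ρ ≤ dist v z) → v + w ∈ Ω := fun v hv => by
    by_contra hn
    have := hv _ hn
    rw [dist_self_add_right] at this
    exact hlt.not_ge this
  refine hz ?_
  have := hΩ (hmem x hx) (hmem y hy) hα hβ hαβ
  rwa [show α • (x + w) + β • (y + w) = z from by
    rw [smul_add, smul_add, add_add_add_comm, ← add_smul, hαβ, one_smul, hw]; abel] at this

omit [NormedSpace ℝ V] in
theorem isCompact_innerParallelBody [ProperSpace V] (Ω : Set V) (ρ R : ℝ) :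
    IsCompact (innerParallelBody Ω ρ R) := by
  refine (isCompact_closedBall 0 R).inter_left ?_
  simp only [Set.ofPred_forall]
  exact isClosed_iInter fun z => isClosed_iInter fun _ => isClosed_le continuous_const (by fun_prop)

omit [NormedSpace ℝ V] in
theorem eventually_mem_innerParallelBody {Ω : Set V} (hΩ : IsOpen Ω) {y : V} (hy : y ∈ Ω) :
    ∀ᶠ k : ℕ in Filter.atTop, y ∈ innerParallelBody Ω (1 / ((k : ℝ) + 1)) k := by
  obtain ⟨ε, hε, hb⟩ := Metric.isOpen_iff.1 hΩ y hy
  filter_upwards [tendsto_one_div_add_atTop_nhds_zero_nat.eventually (gt_mem_nhds hε),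
    tendsto_natCast_atTop_atTop.eventually (Filter.eventually_ge_atTop ‖y‖)] with k h1 h2
  refine ⟨fun z hz => ?_, mem_closedBall_zero_iff.2 h2⟩
  by_contra! h
  exact hz (hb (by rw [Metric.mem_ball, dist_comm]; exact h.trans h1))

variable [FiniteDimensional ℝ V] [MeasurableSpace V] [BorelSpace V]

theorem ContDiffBump.convexOn_convolution (φ : ContDiffBump (0 : V)) (μ : Measure V)
    [μ.IsAddHaarMeasure] {f : V → ℝ} (hf : ConvexOn ℝ Set.univ f) (hfc : Continuous f) :
    ConvexOn ℝ Set.univ (φ.normed μ ⋆[ContinuousLinearMap.lsmul ℝ ℝ, μ] f) := by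
  have hint : ∀ x, Integrable (fun s => φ.normed μ s * f (x - s)) μ := fun x =>
    ((φ.continuous_normed).mul (hfc.comp (by fun_prop))).integrable_of_hasCompactSupport
      (φ.hasCompactSupport_normed.mul_right)
  refine ⟨convex_univ, fun x _ y _ α β hα hβ hαβ => ?_⟩
  change ∫ s, φ.normed μ s * f (α • x + β • y - s) ∂μ ≤
    α * (∫ s, φ.normed μ s * f (x - s) ∂μ) + β * ∫ s, φ.normed μ s * f (y - s) ∂μ
  rw [← integral_const_mul, ← integral_const_mul,
    ← integral_add ((hint x).const_mul α) ((hint y).const_mul β)]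
  refine integral_mono (hint _) (((hint x).const_mul α).add ((hint y).const_mul β)) fun s => ?_
  have h := hf.2 (Set.mem_univ (x - s)) (Set.mem_univ (y - s)) hα hβ hαβ
  rw [show α • (x - s) + β • (y - s) = α • x + β • y - s from by
    rw [smul_sub, smul_sub, sub_add_sub_comm, ← add_smul, hαβ, one_smul]] at h
  have := mul_le_mul_of_nonneg_left h (φ.nonneg_normed (μ := μ) s)
  simp only [smul_eq_mul] at this ⊢
  linarith

theorem exists_concave_cutoff {K Ω : Set V} (hK : IsCompact K) (hKc : Convex ℝ K)
    (hΩ : IsOpen Ω) (hKΩ : K ⊆ Ω) (c : ℝ) :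
    ∃ τ : V → ℝ, ContDiff ℝ ∞ τ ∧ ConcaveOn ℝ Set.univ τ ∧
      (∃ C ⊆ Ω, IsCompact C ∧ ∀ x, 0 < τ x → x ∈ C) ∧ ∀ x ∈ K, c ≤ τ x := by
  rcases K.eq_empty_or_nonempty with rfl | hne
  · exact ⟨fun _ => -1, contDiff_const, concaveOn_const _ convex_univ,
      ⟨∅, by simp, isCompact_empty, fun x hx => by norm_num at hx⟩, by simp⟩
  obtain ⟨δ, hδ, hδΩ⟩ := hK.exists_cthickening_subset_open hΩ hKΩ
  have hδ3 : 0 < δ / 3 := by positivity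
  let φ : ContDiffBump (0 : V) := ⟨δ / 6, δ / 3, by positivity, by linarith⟩
  let μ : Measure V := Measure.addHaar
  let f : V → ℝ := fun x => Metric.infDist x K
  have hfc : Continuous f := Metric.continuous_infDist_pt K
  let F := φ.normed μ ⋆[ContinuousLinearMap.lsmul ℝ ℝ, μ] f
  have hF : ∀ x, |F x - f x| ≤ δ / 3 := fun x => by
    refine φ.dist_normed_convolution_le hfc.aestronglyMeasurable fun y hy => ?_
    calc dist (f y) (f x) ≤ dist y x := by
          simpa using (Metric.lipschitz_infDist_pt K).dist_le_mul y x
      _ ≤ δ / 3 := (Metric.mem_ball.1 hy).le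
  have hFc : ContDiff ℝ ∞ F := φ.hasCompactSupport_normed.contDiff_convolution_left _
    φ.contDiff_normed hfc.locallyIntegrable
  have hFconv : ConvexOn ℝ Set.univ F :=
    φ.convexOn_convolution μ (hKc.convexOn_infDist hK hne) hfc
  set N : ℝ := (|c| + 1) / (δ / 3) with hN
  have hNpos : 0 < N := by positivity
  refine ⟨fun x => N * (2 * (δ / 3) - F x), contDiff_const.mul (contDiff_const.sub hFc), ?_,
    ⟨Metric.cthickening δ K, hδΩ, hK.cthickening, fun x hx => ?_⟩, fun x hx => ?_⟩
  · have h := ((concaveOn_const (2 * (δ / 3)) convex_univ).sub hFconv).smul hNpos.le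
    exact h
  · have h1 : F x < 2 * (δ / 3) := by
      have := (mul_pos_iff_of_pos_left hNpos).1 hx
      linarith
    have h2 : f x < δ := by linarith [(abs_le.1 (hF x)).1]
    exact Metric.thickening_subset_cthickening _ _
      ((Metric.mem_thickening_iff_infDist_lt hne).2 h2)
  · have h1 : f x = 0 := Metric.infDist_zero_of_mem hx
    have h2 : F x ≤ δ / 3 := by linarith [(abs_le.1 (hF x)).2]
    calc c ≤ |c| + 1 := (le_abs_self c).trans (by linarith)
      _ = N * (δ / 3) := by rw [hN, div_mul_cancel₀ _ hδ3.ne']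
      _ ≤ N * (2 * (δ / 3) - F x) := mul_le_mul_of_nonneg_left (by linarith) hNpos.le

/-- A convex open set is exhausted by the positivity sets of smooth concave functions. -/
theorem exists_concave_exhaustion {Ω : Set V} (hΩ : IsOpen Ω) (hc : Convex ℝ Ω) :
    ∃ τ : ℕ → V → ℝ, (∀ k, ContDiff ℝ ∞ (τ k)) ∧ (∀ k, ConcaveOn ℝ Set.univ (τ k)) ∧
      (∀ k, ∃ C ⊆ Ω, IsCompact C ∧ ∀ x, 0 < τ k x → x ∈ C) ∧
      ∀ x ∈ Ω, Filter.Tendsto (fun k => τ k x) Filter.atTop Filter.atTop := by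
  have h := fun k : ℕ => exists_concave_cutoff
    (isCompact_innerParallelBody Ω (1 / ((k : ℝ) + 1)) k) (hc.innerParallelBody _ _) hΩ
    (innerParallelBody_subset Ω (by positivity) _) k
  choose τ h1 h2 h3 h4 using h
  refine ⟨τ, h1, h2, h3, fun x hx => ?_⟩
  refine Filter.tendsto_atTop_mono' _ ?_ tendsto_natCast_atTop_atTop
  filter_upwards [eventually_mem_innerParallelBody hΩ hx] with k hk
  exact h4 k x hk

end ConcaveExhaustion

section Cutoffs

open scoped Matrix Matrix.Norms.Elementwise Topology ContDiff

theorem inv_convexCombination_le {x y α β : ℝ} (hx : 0 < x) (hy : 0 < y) (hα : 0 ≤ α)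
    (hβ : 0 ≤ β) (hαβ : α + β = 1) : (α * x + β * y)⁻¹ ≤ α * x⁻¹ + β * y⁻¹ := by
  have hpos : 0 < α * x + β * y := by
    rcases hα.eq_or_lt with rfl | h
    · rw [zero_add] at hαβ
      subst hαβ
      linarith
    · have := mul_pos h hx
      have := mul_nonneg hβ hy.le
      linarith
  rw [show α * x⁻¹ + β * y⁻¹ = (α * y + β * x) / (x * y) by field_simp, inv_eq_one_div,
    div_le_div_iff₀ hpos (mul_pos hx hy)]
  obtain rfl : β = 1 - α := by linarith
  nlinarith [mul_nonneg (mul_nonneg hα hβ) (sq_nonneg (x - y))]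

theorem ConcaveOn.convexOn_inv {V : Type*} [AddCommGroup V] [Module ℝ V] {U : Set V} {τ : V → ℝ}
    (hτ : ConcaveOn ℝ U τ) (hpos : ∀ x ∈ U, 0 < τ x) : ConvexOn ℝ U fun x => (τ x)⁻¹ := by
  refine ⟨hτ.1, fun x hx y hy α β hα hβ hαβ => ?_⟩
  have h1 := hτ.2 hx hy hα hβ hαβ
  have h2 := inv_convexCombination_le (hpos x hx) (hpos y hy) hα hβ hαβ
  simp only [smul_eq_mul] at h1 ⊢
  refine (inv_anti₀ ?_ h1).trans h2
  rcases hα.eq_or_lt with rfl | h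
  · rw [zero_add] at hαβ
    subst hαβ
    linarith [hpos y hy]
  · have := mul_pos h (hpos x hx)
    have := mul_nonneg hβ (hpos y hy).le
    linarith

theorem expNegInvGlue_of_pos {s : ℝ} (hs : 0 < s) : expNegInvGlue s = Real.exp (-s⁻¹) := by
  simp [expNegInvGlue, hs.not_ge]

variable {V : Type*} [NormedAddCommGroup V] [NormedSpace ℝ V] {r : ℕ}

theorem contDiff_smul_of_eq_zero_off_compact {F : Type*} [NormedAddCommGroup F] [NormedSpace ℝ F]
    {θ : V → ℝ} (hθ : ContDiff ℝ 2 θ) {W C : Set V} (hW : IsOpen W) (hC : IsCompact C)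
    (hCW : C ⊆ W) (hθC : ∀ q ∉ C, θ q = 0) {g : V → F} (hg : ContDiffOn ℝ 2 g W) :
    ContDiff ℝ 2 fun q => θ q • g q := by
  refine contDiff_iff_contDiffAt.2 fun q => ?_
  by_cases hq : q ∈ C
  · exact hθ.contDiffAt.smul (hg.contDiffAt (hW.mem_nhds (hCW hq)))
  · have h0 : (fun q => θ q • g q) =ᶠ[𝓝 q] fun _ => 0 := by
      filter_upwards [hC.isClosed.isOpen_compl.mem_nhds hq] with p hp
      rw [hθC p hp, zero_smul]
    exact contDiffAt_const.congr_of_eventuallyEq h0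

/-- Multiplying a Nakano semi-positive metric by cutoffs built from concave functions. -/
theorem isNakanoBump_of_cutoffs {σ τ : V → ℝ} (hσ : ContDiff ℝ ∞ σ) (hτ : ContDiff ℝ ∞ τ)
    (hσc : ConcaveOn ℝ Set.univ σ) (hτc : ConcaveOn ℝ Set.univ τ) {W C : Set V} (hW : IsOpen W)
    (hC : IsCompact C) (hCW : C ⊆ W) (hUC : ∀ q, 0 < σ q → 0 < τ q → q ∈ C)
    {g : V → Matrix (Fin r) (Fin r) ℂ} (hg : ContDiffOn ℝ 2 g W) (hpos : ∀ q ∈ W, (g q).PosDef)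
    (hN : ∀ q ∈ W, NakanoAt g q) :
    IsNakanoBump {q | 0 < σ q ∧ 0 < τ q}
      (fun q => (expNegInvGlue (σ q) * expNegInvGlue (τ q)) • g q) := by
  set U := {q | 0 < σ q ∧ 0 < τ q} with hU
  have hUo : IsOpen U :=
    (isOpen_lt continuous_const hσ.continuous).inter (isOpen_lt continuous_const hτ.continuous)
  have hUconv : Convex ℝ U := by
    have := (hσc.convex_gt 0).inter (hτc.convex_gt 0)
    simpa [hU, Set.ofPred_and] using this
  have hUW : U ⊆ W := fun q hq => hCW (hUC q hq.1 hq.2)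
  have hzero : ∀ q ∉ U, expNegInvGlue (σ q) * expNegInvGlue (τ q) = 0 := fun q hq => by
    rw [mul_eq_zero, expNegInvGlue.zero_iff_nonpos, expNegInvGlue.zero_iff_nonpos]
    by_contra! h
    exact hq h
  have hθ0 : ∀ q ∉ C, expNegInvGlue (σ q) * expNegInvGlue (τ q) = 0 := fun q hq =>
    hzero q fun h => hq (hUC q h.1 h.2)
  have hfac : ContDiff ℝ 2 fun q => expNegInvGlue (σ q) * expNegInvGlue (τ q) :=
    ((expNegInvGlue.contDiff (n := 2)).comp (contDiff_infty.1 hσ 2)).mul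
      ((expNegInvGlue.contDiff (n := 2)).comp (contDiff_infty.1 hτ 2))
  refine ⟨hUo, hUconv, hC.isBounded.subset fun q hq => hUC q hq.1 hq.2,
    contDiff_smul_of_eq_zero_off_compact hfac hW hC hCW hθ0 hg,
    HasCompactSupport.intro hC fun q hq => by rw [hθ0 q hq, zero_smul],
    fun q hq => ?_, fun q hq => ?_, fun q hq => ?_⟩
  · have h := mul_pos (expNegInvGlue.pos_of_pos hq.1) (expNegInvGlue.pos_of_pos hq.2)
    exact (hpos q (hUW hq)).smul h
  · rw [hzero q hq, zero_smul]
  · have hψ : ConvexOn ℝ U fun q => (σ q)⁻¹ + (τ q)⁻¹ :=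
      ((hσc.subset (Set.subset_univ U) hUconv).convexOn_inv fun q hq => hq.1).add
        ((hτc.subset (Set.subset_univ U) hUconv).convexOn_inv fun q hq => hq.2)
    have hψc : ContDiffOn ℝ 2 (fun q => (σ q)⁻¹ + (τ q)⁻¹) U :=
      ((contDiff_infty.1 hσ 2).contDiffOn.inv fun q hq => hq.1.ne').add
        ((contDiff_infty.1 hτ 2).contDiffOn.inv fun q hq => hq.2.ne')
    have key := (hN q (hUW hq)).exp_neg_smul hUo hψ hψc hq
      (hg.contDiffAt (hW.mem_nhds (hUW hq)))
      (Filter.eventually_of_mem (hW.mem_nhds (hUW hq)) hpos)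
    refine key.congr_of_eventuallyEq ?_
    filter_upwards [hUo.mem_nhds hq] with p hp
    rw [expNegInvGlue_of_pos hp.1, expNegInvGlue_of_pos hp.2, ← Real.exp_add, neg_add]

end Cutoffs

section AppendMeasure

/-- `Fin.append` as a measurable equivalence. -/
def appendMeasurableEquiv (n m : ℕ) : (Fin n → ℝ) × (Fin m → ℝ) ≃ᵐ (Fin (n + m) → ℝ) :=
  (MeasurableEquiv.sumPiEquivProdPi fun _ : Fin n ⊕ Fin m => ℝ).symm.trans
    (MeasurableEquiv.piCongrLeft (fun _ : Fin (n + m) => ℝ) finSumFinEquiv)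

theorem appendMeasurableEquiv_apply {n m : ℕ} (p : (Fin n → ℝ) × (Fin m → ℝ)) :
    appendMeasurableEquiv n m p = Fin.append p.1 p.2 := by
  funext i
  refine Fin.addCases (fun i => ?_) (fun i => ?_) i
  · rw [Fin.append_left, ← finSumFinEquiv_apply_left]
    exact Equiv.piCongrLeft_apply_apply (fun _ : Fin (n + m) => ℝ) finSumFinEquiv _ _
  · rw [Fin.append_right, ← finSumFinEquiv_apply_right]
    exact Equiv.piCongrLeft_apply_apply (fun _ : Fin (n + m) => ℝ) finSumFinEquiv _ _

theorem measurePreserving_appendMeasurableEquiv (n m : ℕ) :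
    MeasurePreserving (appendMeasurableEquiv n m) :=
  (volume_measurePreserving_piCongrLeft (fun _ : Fin (n + m) => ℝ) finSumFinEquiv).comp
    (volume_measurePreserving_sumPiEquivProdPi_symm fun _ : Fin n ⊕ Fin m => ℝ)

end AppendMeasure

section EntryBound

open scoped Matrix

theorem Matrix.PosSemidef.norm_apply_le_sum {r : ℕ} {A : Matrix (Fin r) (Fin r) ℂ}
    (hA : A.PosSemidef) (a b : Fin r) : ‖A a b‖ ≤ ∑ c, (A c c).re := by
  obtain ⟨B, rfl⟩ := hA.exists_conjTranspose_mul_self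
  have hdiag : ∀ c, ((Bᴴ * B) c c).re = ∑ d, ‖B d c‖ ^ 2 := fun c => by
    rw [Matrix.mul_apply, Complex.re_sum]
    refine Finset.sum_congr rfl fun d _ => ?_
    rw [Matrix.conjTranspose_apply, ← Complex.normSq_eq_norm_sq]
    change ((starRingEnd ℂ) (B d c) * B d c).re = _
    rw [← Complex.normSq_eq_conj_mul_self, Complex.ofReal_re]
  simp only [hdiag]
  rw [Finset.sum_comm, Matrix.mul_apply]
  refine (norm_sum_le _ _).trans (Finset.sum_le_sum fun d _ => ?_)
  rw [norm_mul, Matrix.conjTranspose_apply, norm_star]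
  have h : ∀ c, ‖B d c‖ ^ 2 ≤ ∑ c, ‖B d c‖ ^ 2 := fun c =>
    Finset.single_le_sum (f := fun c => ‖B d c‖ ^ 2) (fun _ _ => by positivity) (Finset.mem_univ c)
  nlinarith [h a, h b, sq_nonneg (‖B d a‖ - ‖B d b‖)]

end EntryBound

section FiberLimit

open scoped Topology

/-- Projection of `ℝⁿ⁺ᵐ` onto the first `n` coordinates. -/
def baseProj (n m : ℕ) : (Fin (n + m) → ℝ) →L[ℝ] (Fin n → ℝ) :=
  ContinuousLinearMap.pi fun i => ContinuousLinearMap.proj (Fin.castAdd m i)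

@[simp]
theorem baseProj_append {n m : ℕ} (s : Fin n → ℝ) (x : Fin m → ℝ) :
    baseProj n m (Fin.append s x) = s :=
  funext fun i => Fin.append_left s x i

/-- `f` restricted to `V` consists of the fiber integrals of `Gt` over `Ω`. -/
def IsFiberIntegral {n m r : ℕ} (Ω : Set (Fin (n + m) → ℝ))
    (Gt : (Fin (n + m) → ℝ) → Matrix (Fin r) (Fin r) ℂ) (V : Set (Fin n → ℝ))
    (f : (Fin n → ℝ) → Matrix (Fin r) (Fin r) ℂ) : Prop :=
  ∀ s ∈ V, (f s).PosDef ∧ ∀ a b : Fin r,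
    f s a b = ∫ x in {x : Fin m → ℝ | Fin.append s x ∈ Ω}, Gt (Fin.append s x) a b

variable {n m r : ℕ} {Ω : Set (Fin (n + m) → ℝ)}
  {Gt : (Fin (n + m) → ℝ) → Matrix (Fin r) (Fin r) ℂ} {V : Set (Fin n → ℝ)}
  {f : (Fin n → ℝ) → Matrix (Fin r) (Fin r) ℂ}

theorem IsFiberIntegral.integrableOn_diag (hf : IsFiberIntegral Ω Gt V f) {s : Fin n → ℝ}
    (hs : s ∈ V) (c : Fin r) : IntegrableOn (fun x : Fin m → ℝ => Gt (Fin.append s x) c c)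
      {x | Fin.append s x ∈ Ω} := by
  by_contra h
  have h1 := (hf s hs).2 c c
  rw [integral_undef h] at h1
  exact (hf s hs).1.diag_pos.ne' h1

theorem IsFiberIntegral.integral_trace (hf : IsFiberIntegral Ω Gt V f) {s : Fin n → ℝ}
    (hs : s ∈ V) : ∫ x in {x : Fin m → ℝ | Fin.append s x ∈ Ω},
      ∑ c, (Gt (Fin.append s x) c c).re = ∑ c, (f s c c).re := by
  have hre : ∀ c, IntegrableOn (fun x : Fin m → ℝ => (Gt (Fin.append s x) c c).re)
      {x | Fin.append s x ∈ Ω} := fun c => (hf.integrableOn_diag hs c).re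
  rw [integral_finsetSum _ fun c _ => hre c]
  refine Finset.sum_congr rfl fun c _ => ?_
  rw [(hf s hs).2 c c]
  exact Complex.reCLM.integral_comp_comm (hf.integrableOn_diag hs c)

theorem continuous_append {n m : ℕ} (s : Fin n → ℝ) :
    Continuous fun x : Fin m → ℝ => (Fin.append s x : Fin (n + m) → ℝ) := by
  refine continuous_pi fun i => Fin.addCases (fun i => ?_) (fun i => ?_) i
  · simpa only [Fin.append_left] using continuous_const
  · simpa only [Fin.append_right] using continuous_apply i

theorem measurableSet_append_fiber (hΩ : IsOpen Ω) (s : Fin n → ℝ) :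
    MeasurableSet {x : Fin m → ℝ | Fin.append s x ∈ Ω} :=
  (hΩ.preimage (continuous_append s)).measurableSet

theorem IsFiberIntegral.integrable_trace (hf : IsFiberIntegral Ω Gt V f) (hΩ : IsOpen Ω)
    (hGt : ∀ a b, ContinuousOn (fun q => Gt q a b) Ω) (hpos : ∀ q ∈ Ω, (Gt q).PosDef)
    (hfc : ∀ a b, Continuous fun s => f s a b) {ψ : (Fin n → ℝ) → ℝ} (hψ : Continuous ψ)
    (hψc : HasCompactSupport ψ) (hψV : ∀ s, ψ s ≠ 0 → s ∈ V) :
    Integrable fun q => |ψ (baseProj n m q)| * Ω.indicator (fun q => ∑ c, (Gt q c c).re) q := by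
  have hmeas : AEStronglyMeasurable
      (fun q => |ψ (baseProj n m q)| * Ω.indicator (fun q => ∑ c, (Gt q c c).re) q) := by
    refine (continuous_abs.comp (hψ.comp (baseProj n m).continuous)).aestronglyMeasurable.mul ?_
    refine (aestronglyMeasurable_indicator_iff hΩ.measurableSet).2 ?_
    exact (continuousOn_finsetSum _ fun c _ => Complex.continuous_re.comp_continuousOn
      (hGt c c)).aestronglyMeasurable hΩ.measurableSet
  have hmp := measurePreserving_appendMeasurableEquiv n m
  rw [← hmp.integrable_comp_emb (MeasurableEquiv.measurableEmbedding _)]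
  have hcomp : (fun q => |ψ (baseProj n m q)| * Ω.indicator (fun q => ∑ c, (Gt q c c).re) q) ∘
      appendMeasurableEquiv n m = fun p : (Fin n → ℝ) × (Fin m → ℝ) => |ψ p.1| *
        {x | Fin.append p.1 x ∈ Ω}.indicator (fun x => ∑ c, (Gt (Fin.append p.1 x) c c).re) p.2 := by
    funext p
    simp only [Function.comp, appendMeasurableEquiv_apply, baseProj_append]
    rfl
  have hfiber : ∀ s, Integrable fun x : Fin m → ℝ => |ψ s| *
      {x | Fin.append s x ∈ Ω}.indicator (fun x => ∑ c, (Gt (Fin.append s x) c c).re) x := fun s => by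
    by_cases hs : ψ s = 0
    · simp [hs]
    · refine Integrable.const_mul ?_ _
      rw [integrable_indicator_iff (measurableSet_append_fiber hΩ s)]
      exact integrable_finsetSum _ fun c _ => (hf.integrableOn_diag (hψV s hs) c).re
  have hnorm : ∀ s, ∫ x : Fin m → ℝ, ‖|ψ s| * {x | Fin.append s x ∈ Ω}.indicator
      (fun x => ∑ c, (Gt (Fin.append s x) c c).re) x‖ = |ψ s| * ∑ c, (f s c c).re := fun s => by
    by_cases hs : ψ s = 0
    · simp [hs]
    rw [← hf.integral_trace (hψV s hs), ← integral_indicator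
      (measurableSet_append_fiber hΩ s), ← integral_const_mul]
    refine integral_congr_ae (.of_forall fun x => Real.norm_of_nonneg ?_)
    refine mul_nonneg (abs_nonneg _) (Set.indicator_nonneg (fun x hx => ?_) x)
    exact Finset.sum_nonneg fun c _ => (Complex.pos_iff.1 (hpos _ hx).diag_pos).1.le
  have hmeas' := hmeas.comp_measurePreserving hmp
  rw [hcomp] at hmeas' ⊢
  refine (integrable_prod_iff hmeas').2 ⟨.of_forall hfiber, ?_⟩
  simp only [hnorm]
  refine Continuous.integrable_of_hasCompactSupport ?_ ?_
  · exact (continuous_abs.comp hψ).mul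
      (continuous_finsetSum _ fun c _ => Complex.continuous_re.comp (hfc c c))
  · exact (hψc.comp_left (g := fun x : ℝ => |x|) abs_zero).mul_right

theorem IsFiberIntegral.tendsto_integral_cutoff (hf : IsFiberIntegral Ω Gt V f) (hΩ : IsOpen Ω)
    (hGt : ∀ a b, ContinuousOn (fun q => Gt q a b) Ω) (hpos : ∀ q ∈ Ω, (Gt q).PosDef)
    (hfc : ∀ a b, Continuous fun s => f s a b) {χ : ℕ → (Fin (n + m) → ℝ) → ℝ}
    (hχ : ∀ k, Continuous (χ k)) (hχ1 : ∀ k q, |χ k q| ≤ 1) (hχ0 : ∀ k, ∀ q ∉ Ω, χ k q = 0)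
    (hχΩ : ∀ q ∈ Ω, Filter.Tendsto (fun k => χ k q) Filter.atTop (𝓝 1))
    {ψ : (Fin n → ℝ) → ℝ} (hψ : Continuous ψ) (hψc : HasCompactSupport ψ)
    (hψV : ∀ s, ψ s ≠ 0 → s ∈ V) (a b : Fin r) :
    Filter.Tendsto (fun k => ∫ q, (ψ (baseProj n m q) * χ k q) • Gt q a b) Filter.atTop
      (𝓝 (∫ s, ψ s • f s a b)) := by
  have hbound := hf.integrable_trace hΩ hGt hpos hfc hψ hψc hψV
  have hind : AEStronglyMeasurable (Ω.indicator fun q => Gt q a b) :=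
    (aestronglyMeasurable_indicator_iff hΩ.measurableSet).2
      ((hGt a b).aestronglyMeasurable hΩ.measurableSet)
  have hψb : Continuous fun q => ψ (baseProj n m q) := hψ.comp (baseProj n m).continuous
  have hle : ∀ q, ‖ψ (baseProj n m q) • Ω.indicator (fun q => Gt q a b) q‖ ≤
      |ψ (baseProj n m q)| * Ω.indicator (fun q => ∑ c, (Gt q c c).re) q := fun q => by
    rw [norm_smul, Real.norm_eq_abs]
    refine mul_le_mul_of_nonneg_left ?_ (abs_nonneg _)
    by_cases hq : q ∈ Ω
    · rw [Set.indicator_of_mem hq, Set.indicator_of_mem hq]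
      exact (hpos q hq).posSemidef.norm_apply_le_sum a b
    · rw [Set.indicator_of_notMem hq, Set.indicator_of_notMem hq, norm_zero]
  have hint : Integrable fun q => ψ (baseProj n m q) • Ω.indicator (fun q => Gt q a b) q :=
    hbound.mono' (hψb.aestronglyMeasurable.smul hind) (.of_forall hle)
  have hlim : ∫ q, ψ (baseProj n m q) • Ω.indicator (fun q => Gt q a b) q =
      ∫ s, ψ s • f s a b := by
    have hmp := measurePreserving_appendMeasurableEquiv n m
    have hcomp : ∀ p : (Fin n → ℝ) × (Fin m → ℝ),
        ψ (baseProj n m (appendMeasurableEquiv n m p)) •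
          Ω.indicator (fun q => Gt q a b) (appendMeasurableEquiv n m p) =
        ψ p.1 • {x | Fin.append p.1 x ∈ Ω}.indicator (fun x => Gt (Fin.append p.1 x) a b) p.2 :=
      fun p => by
        simp only [appendMeasurableEquiv_apply, baseProj_append]
        rfl
    have hint' := (hmp.integrable_comp_emb (MeasurableEquiv.measurableEmbedding _)).2 hint
    rw [← hmp.integral_comp']
    simp only [Function.comp_def, hcomp] at hint' ⊢
    refine (integral_prod _ hint').trans (integral_congr_ae (.of_forall fun s => ?_))
    by_cases hs : ψ s = 0
    · simp [hs]
    · simp only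
      rw [integral_smul, integral_indicator (measurableSet_append_fiber hΩ s),
        (hf s (hψV s hs)).2 a b]
  have heq : ∀ k q, (ψ (baseProj n m q) * χ k q) • Gt q a b =
      χ k q • ψ (baseProj n m q) • Ω.indicator (fun q => Gt q a b) q := fun k q => by
    by_cases hq : q ∈ Ω
    · rw [Set.indicator_of_mem hq, smul_smul, mul_comm]
    · rw [hχ0 k q hq, mul_zero, zero_smul, zero_smul]
  simp only [heq]
  rw [← hlim]
  refine tendsto_integral_of_dominated_convergence _ (fun k =>
    (hχ k).aestronglyMeasurable.smul hint.aestronglyMeasurable) hbound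
    (fun k => .of_forall fun q => ?_) (.of_forall fun q => ?_)
  · rw [norm_smul, Real.norm_eq_abs]
    exact (mul_le_of_le_one_left (norm_nonneg _) (hχ1 k q)).trans (hle q)
  · by_cases hq : q ∈ Ω
    · simpa using (hχΩ q hq).smul_const (ψ (baseProj n m q) • Ω.indicator (fun q => Gt q a b) q)
    · simp only [Set.indicator_of_notMem hq, smul_zero]
      exact tendsto_const_nhds

end FiberLimit

section Mollifier

open scoped Topology

variable {T F X : Type} [NormedAddCommGroup T] [NormedSpace ℝ T] [NormedAddCommGroup F]
  [NormedSpace ℝ F] [NormedAddCommGroup X] [NormedSpace ℝ X]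

theorem hasCompactSupport_smul_comp_sub {φ : T → ℝ} (hφ : HasCompactSupport φ) {M : X → F}
    (hM : HasCompactSupport M) (π : X →L[ℝ] T) :
    HasCompactSupport fun p : T × X => φ (p.1 - π p.2) • M p.2 := by
  have hK : IsCompact ((fun p : T × X => (p.1 + π p.2, p.2)) '' tsupport φ ×ˢ tsupport M) :=
    (hφ.isCompact.prod hM.isCompact).image (by fun_prop)
  refine HasCompactSupport.intro hK fun p hp => ?_
  by_contra h
  have h1 := left_ne_zero_of_smul h
  have h2 := right_ne_zero_of_smul h
  exact hp ⟨(p.1 - π p.2, p.2), ⟨subset_tsupport _ h1, subset_tsupport _ h2⟩, by simp⟩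

section Kernel

variable [MeasureSpace X] [BorelSpace X] [SecondCountableTopology X]
  [IsFiniteMeasureOnCompacts (volume : Measure X)]

theorem fderiv_integral_smul_comp_sub {φ : T → ℝ} (hφ : ContDiff ℝ 1 φ)
    (hφc : HasCompactSupport φ) {M : X → F} (hM : ContDiff ℝ 1 M) (hMc : HasCompactSupport M)
    (π : X →L[ℝ] T) (t e : T) :
    fderiv ℝ (fun t => ∫ x, φ (t - π x) • M x) t e = ∫ x, fderiv ℝ φ (t - π x) e • M x := by
  have hsub : ContDiff ℝ 1 fun p : T × X => p.1 - π p.2 := by fun_prop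
  have hf : ContDiff ℝ 1 fun p : T × X => φ (p.1 - π p.2) • M p.2 :=
    (hφ.comp hsub).smul (hM.comp contDiff_snd)
  refine (fderiv_integral_fiber hf (hasCompactSupport_smul_comp_sub hφc hMc π) t e).trans
    (integral_congr_ae (.of_forall fun x => ?_))
  have h1 : HasFDerivAt (fun p : T × X => φ (p.1 - π p.2))
      ((fderiv ℝ φ (t - π x)).comp (ContinuousLinearMap.fst ℝ T X -
        π.comp (ContinuousLinearMap.snd ℝ T X))) (t, x) :=
    HasFDerivAt.comp (t, x) (g := φ) (f := fun p : T × X => p.1 - π p.2)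
      (hφ.differentiable (by norm_num) _).hasFDerivAt
      ((hasFDerivAt_fst).sub (π.hasFDerivAt.comp (t, x) hasFDerivAt_snd))
  have h2 : HasFDerivAt (fun p : T × X => M p.2)
      ((fderiv ℝ M x).comp (ContinuousLinearMap.snd ℝ T X)) (t, x) :=
    HasFDerivAt.comp (t, x) (g := M) (f := fun p : T × X => p.2)
      (hM.differentiable (by norm_num) _).hasFDerivAt hasFDerivAt_snd
  simp only
  rw [(h1.fun_smul h2).fderiv]
  simp

theorem fderiv_fderiv_integral_smul_comp_sub {φ : T → ℝ} (hφ : ContDiff ℝ 2 φ)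
    (hφc : HasCompactSupport φ) {M : X → F} (hM : ContDiff ℝ 1 M) (hMc : HasCompactSupport M)
    (π : X →L[ℝ] T) (t e e' : T) :
    fderiv ℝ (fun q => fderiv ℝ (fun t => ∫ x, φ (t - π x) • M x) q e) t e' =
      ∫ x, fderiv ℝ (fun y => fderiv ℝ φ y e) (t - π x) e' • M x := by
  rw [show (fun q => fderiv ℝ (fun t => ∫ x, φ (t - π x) • M x) q e) = _ from
    funext fun q => fderiv_integral_smul_comp_sub (hφ.of_le (by norm_num)) hφc hM hMc π q e]
  exact fderiv_integral_smul_comp_sub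
    ((hφ.fderiv_right (m := 1) (by norm_num)).clm_apply contDiff_const)
    (hφc.fderiv_apply ℝ e) hM hMc π t e'

end Kernel

variable [MeasureSpace T] [BorelSpace T] [FiniteDimensional ℝ T]
  [(volume : Measure T).IsAddHaarMeasure]

theorem integral_fderiv_smul_comp_sub {φ : T → ℝ} (hφ : ContDiff ℝ 1 φ)
    (hφc : HasCompactSupport φ) {M : T → F} (hM : ContDiff ℝ 1 M) (t e : T) :
    ∫ s, fderiv ℝ φ (t - s) e • M s = ∫ s, φ (t - s) • fderiv ℝ M s e := by
  have hemb : Topology.IsClosedEmbedding fun s : T => t - s := (Homeomorph.subLeft t).isClosedEmbedding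
  have hc : HasCompactSupport fun s => φ (t - s) := hφc.comp_isClosedEmbedding hemb
  have hc' : HasCompactSupport fun s => fderiv ℝ φ (t - s) e :=
    (hφc.fderiv_apply ℝ e).comp_isClosedEmbedding hemb
  have hd : ∀ s, fderiv ℝ (fun s => φ (t - s)) s e = -fderiv ℝ φ (t - s) e := fun s => by
    have h : HasFDerivAt (fun s => φ (t - s)) ((fderiv ℝ φ (t - s)).comp
        (-ContinuousLinearMap.id ℝ T)) s :=
      HasFDerivAt.comp s (g := φ) (f := fun s => t - s)
        (hφ.differentiable (by norm_num) _).hasFDerivAt ((hasFDerivAt_id s).const_sub t)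
    rw [h.fderiv]
    simp
  have hφ' : Continuous fun s => fderiv ℝ φ (t - s) e :=
    ((hφ.continuous_fderiv (by norm_num)).clm_apply continuous_const).comp
      (continuous_const.sub continuous_id)
  have hφ0 : Continuous fun s => φ (t - s) :=
    hφ.continuous.comp (continuous_const.sub continuous_id)
  have hM' : Continuous fun s => fderiv ℝ M s e :=
    (hM.continuous_fderiv (by norm_num)).clm_apply continuous_const
  rw [integral_smul_fderiv_eq_neg_fderiv_smul_of_integrable (f := fun s => φ (t - s)) (g := M)
    (v := e)]
  · simp only [hd, neg_smul, integral_neg, neg_neg]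
  · simp only [hd, neg_smul]
    exact ((hφ'.smul hM.continuous).integrable_of_hasCompactSupport hc'.smul_right).neg
  · exact (hφ0.smul hM').integrable_of_hasCompactSupport hc.smul_right
  · exact (hφ0.smul hM.continuous).integrable_of_hasCompactSupport hc.smul_right
  · exact fun s _ => (hφ.differentiable (by norm_num) _).comp s (by fun_prop)
  · exact fun s _ => hM.differentiable (by norm_num) s

theorem integral_fderiv_fderiv_smul_comp_sub {φ : T → ℝ} (hφ : ContDiff ℝ 2 φ)
    (hφc : HasCompactSupport φ) {M : T → F} (hM : ContDiff ℝ 2 M) (t e e' : T) :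
    ∫ s, fderiv ℝ (fun y => fderiv ℝ φ y e) (t - s) e' • M s =
      ∫ s, φ (t - s) • fderiv ℝ (fun y => fderiv ℝ M y e) s e' := by
  rw [integral_fderiv_smul_comp_sub ((hφ.fderiv_right (m := 1) (by norm_num)).clm_apply
    contDiff_const) (hφc.fderiv_apply ℝ e) (hM.of_le (by norm_num))]
  simp only [fderiv_fderiv_apply_comm hM.contDiffAt e e']
  exact integral_fderiv_smul_comp_sub (hφ.of_le (by norm_num)) hφc
    ((hM.fderiv_right (m := 1) (by norm_num)).clm_apply contDiff_const) t e

/-- Mollification by normalised nonnegative kernels supported near the origin. -/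
theorem tendsto_integral_smul_comp_sub [CompleteSpace F] {ι : Type*} {l : Filter ι} {φ : ι → T → ℝ}
    (hφ0 : ∀ i y, 0 ≤ φ i y) (hφpos : ∀ᶠ i in l, ∫ y, φ i y ≠ 0)
    (hsupp : Filter.Tendsto (fun i => Function.support (φ i)) l (𝓝 0).smallSets)
    {M : T → F} (hM : Continuous M) (t : T) :
    Filter.Tendsto (fun i => (∫ y, φ i y)⁻¹ • ∫ s, φ i (t - s) • M s) l (𝓝 (M t)) := by
  have h := convolution_tendsto_right (μ := (volume : Measure T)) (l := l) (x₀ := t) (z₀ := M t)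
    (φ := fun i y => (∫ y, φ i y)⁻¹ * φ i y) (g := fun _ => M) (k := fun _ => t)
    (.of_forall fun i y => mul_nonneg (inv_nonneg.2 (integral_nonneg (hφ0 i))) (hφ0 i y))
    (hφpos.mono fun i hi => by rw [integral_const_mul, inv_mul_cancel₀ hi])
    (hsupp.smallSets_mono (.of_forall fun i y hy => right_ne_zero_of_mul hy))
    (.of_forall fun _ => hM.aestronglyMeasurable)
    ((hM.tendsto t).comp Filter.tendsto_snd) tendsto_const_nhds
  refine h.congr fun i => ?_
  rw [convolution_def, ← integral_smul, ← integral_sub_left_eq_self _ volume t]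
  refine integral_congr_ae (.of_forall fun s => ?_)
  simp [mul_smul]

end Mollifier

section FiberMollify

theorem ContinuousLinearMap.map_integral_of_hasCompactSupport {X F F' : Type*}
    [NormedAddCommGroup X] [MeasureSpace X] [BorelSpace X]
    [IsFiniteMeasureOnCompacts (volume : Measure X)] [NormedAddCommGroup F] [NormedSpace ℝ F]
    [CompleteSpace F] [NormedAddCommGroup F'] [NormedSpace ℝ F'] [CompleteSpace F']
    (L : F →L[ℝ] F') {M : X → F} (hM : Continuous M) (hc : HasCompactSupport M) :
    L (∫ x, M x) = ∫ x, L (M x) :=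
  (L.integral_comp_comm (hM.integrable_of_hasCompactSupport hc)).symm

open scoped Matrix Matrix.Norms.Elementwise Topology ContDiff

theorem matrix_integral_apply {X : Type*} [NormedAddCommGroup X] [MeasureSpace X] [BorelSpace X]
    [IsFiniteMeasureOnCompacts (volume : Measure X)] {r : ℕ} {M : X → Matrix (Fin r) (Fin r) ℂ}
    (hM : Continuous M) (hc : HasCompactSupport M) (a b : Fin r) :
    (∫ x, M x) a b = ∫ x, M x a b :=
  ContinuousLinearMap.map_integral_of_hasCompactSupport
    (LinearMap.toContinuousLinearMap
      { toFun := fun A : Matrix (Fin r) (Fin r) ℂ => A a b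
        map_add' := fun _ _ => rfl
        map_smul' := fun _ _ => rfl }) hM hc

variable {n m r : ℕ} {Ω : Set (Fin (n + m) → ℝ)}
  {Gt : (Fin (n + m) → ℝ) → Matrix (Fin r) (Fin r) ℂ} {V : Set (Fin n → ℝ)}
  {f : (Fin n → ℝ) → Matrix (Fin r) (Fin r) ℂ}

/-- Convolution of a matrix-valued function with a scalar kernel. -/
def mollify (φ : (Fin n → ℝ) → ℝ) (f : (Fin n → ℝ) → Matrix (Fin r) (Fin r) ℂ)
    (t : Fin n → ℝ) : Matrix (Fin r) (Fin r) ℂ :=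
  ∫ s, φ (t - s) • f s

theorem tendsto_expNegInvGlue_atTop :
    Filter.Tendsto expNegInvGlue Filter.atTop (𝓝 1) := by
  have h : Filter.Tendsto (fun s : ℝ => Real.exp (-s⁻¹)) Filter.atTop (𝓝 1) := by
    have := (Real.continuous_exp.tendsto (-0)).comp tendsto_inv_atTop_zero.neg
    simpa [Function.comp_def] using this
  refine h.congr' ?_
  filter_upwards [Filter.eventually_gt_atTop 0] with s hs
  rw [expNegInvGlue_of_pos hs]

theorem abs_expNegInvGlue_le_one (s : ℝ) : |expNegInvGlue s| ≤ 1 := by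
  rw [abs_of_nonneg (expNegInvGlue.nonneg s)]
  rcases le_or_gt s 0 with hs | hs
  · rw [expNegInvGlue.zero_of_nonpos hs]
    exact zero_le_one
  · rw [expNegInvGlue_of_pos hs, Real.exp_le_one_iff, neg_nonpos]
    exact inv_nonneg.2 hs.le

/-- Fiber integrals of a Nakano semi-positive metric over a convex set are Nakano semi-positive
after mollification by a kernel built from a concave function. -/
theorem IsFiberIntegral.nakanoValue_mollify_nonneg (hf : IsFiberIntegral Ω Gt V f)
    (hΩ : IsOpen Ω) (hΩc : Convex ℝ Ω) (hGt : ContDiffOn ℝ 2 Gt Ω)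
    (hpos : ∀ q ∈ Ω, (Gt q).PosDef) (hN : ∀ q ∈ Ω, NakanoAt Gt q) (hf2 : ContDiff ℝ 2 f)
    {σ : (Fin n → ℝ) → ℝ} (hσ : ContDiff ℝ ∞ σ) (hσc : ConcaveOn ℝ Set.univ σ)
    {K : Set (Fin n → ℝ)} (hK : IsCompact K) (hσK : ∀ y, 0 < σ y → y ∈ K) {t : Fin n → ℝ}
    (hKV : ∀ y ∈ K, t - y ∈ V) (ht : ∃ q ∈ Ω, 0 < σ (t - baseProj n m q))
    (hu : IsUnit (mollify (fun y => expNegInvGlue (σ y)) f t)) {k : ℕ} (e : Fin k → Fin n → ℝ)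
    (u : Fin k → Fin r → ℂ) :
    0 ≤ nakanoValue (mollify (fun y => expNegInvGlue (σ y)) f t)
      (∑ i, mollify (fun y => expNegInvGlue (σ y)) (fun s => fderiv ℝ f s (e i)) t *ᵥ u i)
      (∑ i, ∑ j, star (u j) ⬝ᵥ mollify (fun y => expNegInvGlue (σ y))
        (fun s => fderiv ℝ (fun q => fderiv ℝ f q (e i)) s (e j)) t *ᵥ u i) := by
  obtain ⟨τ, hτ, hτc, hτC, hτlim⟩ := exists_concave_exhaustion hΩ hΩc
  choose C hCΩ hC hτC using hτC
  set π := baseProj n m with hπ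
  set φ : (Fin n → ℝ) → ℝ := fun y => expNegInvGlue (σ y) with hφ
  set χ : ℕ → (Fin (n + m) → ℝ) → ℝ := fun k q => expNegInvGlue (τ k q) with hχ
  set M : ℕ → (Fin (n + m) → ℝ) → Matrix (Fin r) (Fin r) ℂ := fun k q => χ k q • Gt q with hM
  have hφ2 : ContDiff ℝ 2 φ := (expNegInvGlue.contDiff (n := 2)).comp (contDiff_infty.1 hσ 2)
  have hφK : tsupport φ ⊆ K := by
    refine closure_minimal (fun y hy => hσK y ?_) hK.isClosed
    by_contra h
    exact hy (expNegInvGlue.zero_of_nonpos (not_lt.1 h))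
  have hφc : HasCompactSupport φ := hK.of_isClosed_subset (isClosed_tsupport φ) hφK
  have hχ2 : ∀ k, ContDiff ℝ 2 (χ k) := fun k =>
    (expNegInvGlue.contDiff (n := 2)).comp (contDiff_infty.1 (hτ k) 2)
  have hχ0 : ∀ k, ∀ q ∉ C k, χ k q = 0 := fun k q hq =>
    expNegInvGlue.zero_of_nonpos (not_lt.1 fun h => hq (hτC k q h))
  have hM2 : ∀ k, ContDiff ℝ 2 (M k) := fun k =>
    contDiff_smul_of_eq_zero_off_compact (hχ2 k) hΩ (hC k) (hCΩ k) (hχ0 k) hGt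
  have hM0 : ∀ k, ∀ q ∉ C k, M k q = 0 := fun k q hq =>
    (congrArg (· • Gt q) (hχ0 k q hq)).trans (zero_smul ℝ (Gt q))
  have hMc : ∀ k, HasCompactSupport (M k) := fun k => HasCompactSupport.intro (hC k) (hM0 k)
  have hGt' : ∀ a b, ContinuousOn (fun q => Gt q a b) Ω := fun a b =>
    (continuous_apply_apply a b).comp_continuousOn hGt.continuousOn
  have hfab : ∀ a b, Continuous fun s => f s a b := fun a b =>
    (continuous_apply_apply a b).comp hf2.continuous
  have hsub : Topology.IsClosedEmbedding fun s : Fin n → ℝ => t - s :=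
    (Homeomorph.subLeft t).isClosedEmbedding
  have hlim : ∀ ψ : (Fin n → ℝ) → ℝ, Continuous ψ → tsupport ψ ⊆ K →
      Filter.Tendsto (fun k => ∫ q, ψ (t - π q) • M k q) Filter.atTop
        (𝓝 (mollify ψ f t)) := fun ψ hψ hψK => by
    have hψc : HasCompactSupport ψ := hK.of_isClosed_subset (isClosed_tsupport ψ) hψK
    have hψt : Continuous fun s => ψ (t - s) := hψ.comp hsub.continuous
    have hψtc : HasCompactSupport fun s => ψ (t - s) := hψc.comp_isClosedEmbedding hsub
    refine tendsto_pi_nhds.2 fun a => tendsto_pi_nhds.2 fun b => ?_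
    have h1 := hf.tendsto_integral_cutoff hΩ hGt' hpos hfab (fun k => (hχ2 k).continuous)
      (fun k q => abs_expNegInvGlue_le_one _) (fun k q hq => hχ0 k q fun h => hq (hCΩ k h))
      (fun q hq => tendsto_expNegInvGlue_atTop.comp (hτlim q hq)) hψt hψtc
      (fun s hs => by
        have := hKV _ (hψK (subset_tsupport _ hs))
        rwa [sub_sub_cancel] at this) a b
    have h2 : mollify ψ f t a b = ∫ s, ψ (t - s) • f s a b :=
      matrix_integral_apply (hψt.smul hf2.continuous) hψtc.smul_right a b
    have h3 : ∀ k, (∫ q, ψ (t - π q) • M k q) a b =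
        ∫ q, (ψ (t - π q) * χ k q) • Gt q a b := fun k => by
      have hc : Continuous fun q => ψ (t - π q) • M k q :=
        (hψt.comp π.continuous).smul (hM2 k).continuous
      have hcs : HasCompactSupport fun q => ψ (t - π q) • M k q :=
        HasCompactSupport.intro (hC k) fun q hq => by rw [hM0 k q hq, smul_zero]
      refine (matrix_integral_apply hc hcs a b).trans (integral_congr_ae (.of_forall fun q => ?_))
      exact smul_smul (ψ (t - π q)) (χ k q) (Gt q a b)
    rw [h2]
    exact h1.congr fun k => (h3 k).symm
  have hjet1 : ∀ k e, fderiv ℝ (fun t => ∫ q, φ (t - π q) • M k q) t e =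
      ∫ q, fderiv ℝ φ (t - π q) e • M k q := fun k e =>
    fderiv_integral_smul_comp_sub (hφ2.of_le (by norm_num)) hφc ((hM2 k).of_le (by norm_num))
      (hMc k) π t e
  have hjet2 : ∀ k e e', fderiv ℝ (fun q => fderiv ℝ (fun t => ∫ q, φ (t - π q) • M k q) q e) t e' =
      ∫ q, fderiv ℝ (fun y => fderiv ℝ φ y e) (t - π q) e' • M k q := fun k e e' =>
    fderiv_fderiv_integral_smul_comp_sub hφ2 hφc ((hM2 k).of_le (by norm_num)) (hMc k) π t e e'
  have hmol1 : ∀ e, mollify (fun y => fderiv ℝ φ y e) f t =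
      mollify φ (fun s => fderiv ℝ f s e) t := fun e =>
    integral_fderiv_smul_comp_sub (hφ2.of_le (by norm_num)) hφc (hf2.of_le (by norm_num)) t e
  have hmol2 : ∀ e e', mollify (fun y => fderiv ℝ (fun y => fderiv ℝ φ y e) y e') f t =
      mollify φ (fun s => fderiv ℝ (fun q => fderiv ℝ f q e) s e') t := fun e e' =>
    integral_fderiv_fderiv_smul_comp_sub hφ2 hφc hf2 t e e'
  have hφ1 : ∀ e, ContDiff ℝ 1 fun y => fderiv ℝ φ y e := fun e =>
    (hφ2.fderiv_right (m := 1) (by norm_num)).clm_apply contDiff_const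
  have hlim1 : ∀ e, Filter.Tendsto (fun k => fderiv ℝ (fun t => ∫ q, φ (t - π q) • M k q) t e)
      Filter.atTop (𝓝 (mollify φ (fun s => fderiv ℝ f s e) t)) := fun e => by
    rw [← hmol1]
    exact (hlim _ (hφ1 e).continuous ((tsupport_fderiv_apply_subset ℝ e).trans hφK)).congr
      fun k => (hjet1 k e).symm
  have hlim2 : ∀ e e', Filter.Tendsto
      (fun k => fderiv ℝ (fun q => fderiv ℝ (fun t => ∫ q, φ (t - π q) • M k q) q e) t e')
      Filter.atTop (𝓝 (mollify φ (fun s => fderiv ℝ (fun q => fderiv ℝ f q e) s e') t)) :=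
    fun e e' => by
    rw [← hmol2]
    refine (hlim _ (((hφ1 e).continuous_fderiv (by norm_num)).clm_apply continuous_const)
      (((tsupport_fderiv_apply_subset ℝ e').trans (tsupport_fderiv_apply_subset ℝ e)).trans
        hφK)).congr fun k => (hjet2 k e e').symm
  refine ge_of_tendsto (tendsto_nakanoValue (hlim φ hφ2.continuous hφK)
    (tendsto_finsetSum _ fun i _ =>
      ((mulVecCLM (u i)).continuous.tendsto _).comp (hlim1 (e i)))
    (tendsto_finsetSum _ fun i _ => tendsto_finsetSum _ fun j _ =>
      (((starDotCLM (u j)).comp (mulVecCLM (u i))).continuous.tendsto _).comp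
        (hlim2 (e i) (e j))) hu) ?_
  obtain ⟨q, hq, hσq⟩ := ht
  filter_upwards [(hτlim q hq).eventually_gt_atTop 0] with k hk
  obtain ⟨R, hR⟩ := ((hK.isBounded.add ((hC k).image π.continuous).isBounded)).subset_closedBall 0
  have hσc' : ConcaveOn ℝ Set.univ fun p : (Fin n → ℝ) × (Fin (n + m) → ℝ) => σ (p.1 - π p.2) :=
    hσc.comp_linearMap (LinearMap.fst ℝ (Fin n → ℝ) (Fin (n + m) → ℝ) -
      π.toLinearMap ∘ₗ LinearMap.snd ℝ (Fin n → ℝ) (Fin (n + m) → ℝ))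
  have hτc' : ConcaveOn ℝ Set.univ fun p : (Fin n → ℝ) × (Fin (n + m) → ℝ) => τ k p.2 :=
    (hτc k).comp_linearMap (LinearMap.snd ℝ (Fin n → ℝ) (Fin (n + m) → ℝ))
  have hbump := isNakanoBump_of_cutoffs (V := (Fin n → ℝ) × (Fin (n + m) → ℝ))
    (σ := fun p => σ (p.1 - π p.2)) (τ := fun p => τ k p.2) (W := Set.univ ×ˢ Ω)
    (C := Metric.closedBall 0 R ×ˢ C k) (g := fun p => Gt p.2)
    (hσ.comp (by fun_prop)) ((hτ k).comp contDiff_snd)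
    hσc' hτc'
    (isOpen_univ.prod hΩ) ((isCompact_closedBall 0 R).prod (hC k))
    (Set.prod_mono (Set.subset_univ _) (hCΩ k))
    (fun p h1 h2 => ⟨hR ⟨_, hσK _ h1, _, ⟨p.2, hτC k _ h2, rfl⟩, sub_add_cancel _ _⟩,
      hτC k _ h2⟩)
    (hGt.comp contDiffOn_snd fun p hp => hp.2) (fun p hp => hpos _ hp.2)
    (fun p hp => (hN _ hp.2).comp_continuousLinearMap
      (ContinuousLinearMap.snd ℝ (Fin n → ℝ) (Fin (n + m) → ℝ))
      (hGt.contDiffAt (hΩ.mem_nhds hp.2)))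
  have hNk := (hbump.integral_pi (n + m)).nakanoAt t ⟨(t, q), ⟨hσq, hk⟩, rfl⟩
  simp only [mul_smul] at hNk
  exact hNk _ e u

end FiberMollify

section Conclusion

open scoped Matrix Matrix.Norms.Elementwise Topology ContDiff

theorem nakanoValue_smul {r : ℕ} {c : ℝ} (hc : c ≠ 0) (A : Matrix (Fin r) (Fin r) ℂ)
    (v : Fin r → ℂ) (H : ℂ) : nakanoValue (c • A) (c • v) (c • H) = c * nakanoValue A v H := by
  have hinv : (c • A)⁻¹ = c⁻¹ • A⁻¹ := by
    by_cases hA : IsUnit A.det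
    · refine Matrix.inv_eq_right_inv ?_
      rw [Matrix.smul_mul, Matrix.mul_smul, smul_smul, mul_inv_cancel₀ hc, one_smul,
        Matrix.mul_nonsing_inv _ hA]
    · have hA' : ¬ IsUnit (c • A).det := by
        have h : (c • A).det = (c : ℂ) ^ r * A.det := by
          have := Matrix.det_smul A (c : ℂ)
          rwa [Fintype.card_fin] at this
        rw [h, isUnit_iff_ne_zero, mul_ne_zero_iff, not_and_or]
        exact Or.inr (isUnit_iff_ne_zero.not.1 hA)
      rw [Matrix.nonsing_inv_apply_not_isUnit _ hA, Matrix.nonsing_inv_apply_not_isUnit _ hA',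
        smul_zero]
  have hstar : star (c • v) = c • star v := by
    rw [star_smul, star_trivial]
  unfold nakanoValue
  rw [hinv, hstar, Matrix.smul_mulVec, Matrix.mulVec_smul, smul_smul, inv_mul_cancel₀ hc, one_smul,
    smul_dotProduct, ← smul_sub, Complex.smul_re, smul_eq_mul]

/-- A rotation-invariant bump function at scale `ε`. -/
def glueKernel (n : ℕ) (ε : ℝ) (y : Fin n → ℝ) : ℝ :=
  expNegInvGlue (ε ^ 2 - ∑ i, y i ^ 2)

theorem mem_closedBall_of_sum_sq_lt {n : ℕ} {ε : ℝ} (hε : 0 ≤ ε) {y : Fin n → ℝ}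
    (hy : 0 < ε ^ 2 - ∑ i, y i ^ 2) : y ∈ Metric.closedBall (0 : Fin n → ℝ) ε := by
  rw [mem_closedBall_zero_iff, pi_norm_le_iff_of_nonneg hε]
  intro i
  have h : y i ^ 2 ≤ ∑ i, y i ^ 2 := Finset.single_le_sum (f := fun i => y i ^ 2) (fun i _ => sq_nonneg _)
    (Finset.mem_univ i)
  exact abs_le_of_sq_le_sq (by linarith) hε

theorem contDiff_sub_sum_sq (n : ℕ) (ε : ℝ) :
    ContDiff ℝ ∞ fun y : Fin n → ℝ => ε ^ 2 - ∑ i, y i ^ 2 := by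
  fun_prop

theorem concaveOn_sub_sum_sq (n : ℕ) (ε : ℝ) :
    ConcaveOn ℝ Set.univ fun y : Fin n → ℝ => ε ^ 2 - ∑ i, y i ^ 2 := by
  refine ⟨convex_univ, fun x _ y _ α β hα hβ hαβ => ?_⟩
  have h : ∀ i, (α * x i + β * y i) ^ 2 ≤ α * x i ^ 2 + β * y i ^ 2 := fun i => by
    obtain rfl : β = 1 - α := by linarith
    nlinarith [mul_nonneg (mul_nonneg hα hβ) (sq_nonneg (x i - y i))]
  have h2 := Finset.sum_le_sum fun i (_ : i ∈ Finset.univ) => h i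
  rw [Finset.sum_add_distrib, ← Finset.mul_sum, ← Finset.mul_sum] at h2
  simp only [smul_eq_mul, Pi.add_apply, Pi.smul_apply]
  have h3 : α * ε ^ 2 + β * ε ^ 2 = ε ^ 2 := by rw [← add_mul, hαβ, one_mul]
  linarith

theorem support_glueKernel_subset {n : ℕ} {ε : ℝ} (hε : 0 ≤ ε) :
    Function.support (glueKernel n ε) ⊆ Metric.closedBall 0 ε := fun y hy => by
  refine mem_closedBall_of_sum_sq_lt hε ?_
  by_contra h
  exact hy (expNegInvGlue.zero_of_nonpos (not_lt.1 h))

theorem integral_glueKernel_pos {n : ℕ} {ε : ℝ} (hε : 0 < ε) :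
    0 < ∫ y, glueKernel n ε y := by
  have hc : Continuous (glueKernel n ε) :=
    (expNegInvGlue.contDiff (n := 0)).continuous.comp (contDiff_sub_sum_sq n ε).continuous
  refine hc.integral_pos_of_hasCompactSupport_nonneg_nonzero
    (HasCompactSupport.of_support_subset_isCompact (isCompact_closedBall 0 ε)
      (support_glueKernel_subset hε.le)) (fun y => expNegInvGlue.nonneg _) (x := 0) ?_
  exact (expNegInvGlue.pos_of_pos (by simpa using pow_pos hε 2)).ne'

theorem tendsto_integral_glueKernel {n : ℕ} {F : Type} [NormedAddCommGroup F] [NormedSpace ℝ F]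
    [CompleteSpace F] {g : (Fin n → ℝ) → F} (hg : Continuous g) (t : Fin n → ℝ) :
    Filter.Tendsto (fun ε => (∫ y, glueKernel n ε y)⁻¹ • ∫ s, glueKernel n ε (t - s) • g s)
      (𝓝[>] 0) (𝓝 (g t)) := by
  refine tendsto_integral_smul_comp_sub (fun ε y => expNegInvGlue.nonneg _) ?_ ?_ hg t
  · filter_upwards [self_mem_nhdsWithin] with ε hε
    exact (integral_glueKernel_pos hε).ne'
  · refine Filter.tendsto_smallSets_iff.2 fun S hS => ?_
    obtain ⟨δ, hδ, hδS⟩ := Metric.nhds_basis_closedBall.mem_iff.1 hS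
    filter_upwards [Ioc_mem_nhdsGT hδ] with ε hε
    exact (support_glueKernel_subset hε.1.le).trans
      ((Metric.closedBall_subset_closedBall hε.2).trans hδS)

variable {n m r : ℕ} {Ω : Set (Fin (n + m) → ℝ)}
  {Gt : (Fin (n + m) → ℝ) → Matrix (Fin r) (Fin r) ℂ} {V : Set (Fin n → ℝ)}
  {f : (Fin n → ℝ) → Matrix (Fin r) (Fin r) ℂ}

theorem tendsto_mollify_glueKernel (hf : Continuous f) (t : Fin n → ℝ) :
    Filter.Tendsto (fun ε => (∫ y, glueKernel n ε y)⁻¹ • mollify (glueKernel n ε) f t)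
      (𝓝[>] 0) (𝓝 (f t)) :=
  tendsto_integral_glueKernel hf t

/-- Fiber integrals of a Nakano semi-positive metric over a convex set are Nakano
semi-positive. -/
theorem IsFiberIntegral.nakanoAt (hf : IsFiberIntegral Ω Gt V f)
    (hΩ : IsOpen Ω) (hΩc : Convex ℝ Ω) (hGt : ContDiffOn ℝ 2 Gt Ω)
    (hpos : ∀ q ∈ Ω, (Gt q).PosDef) (hN : ∀ q ∈ Ω, NakanoAt Gt q) (hf2 : ContDiff ℝ 2 f)
    {t : Fin n → ℝ} (hV : V ∈ 𝓝 t) (ht : ∃ q ∈ Ω, baseProj n m q = t) : NakanoAt f t := by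
  intro k e u
  have hunit : IsUnit (f t) := (hf t (mem_of_mem_nhds hV)).1.isUnit
  have h1 : ∀ e, Continuous fun s => fderiv ℝ f s e := fun e =>
    (hf2.continuous_fderiv (by norm_num)).clm_apply continuous_const
  have h2 : ∀ e e', Continuous fun s => fderiv ℝ (fun q => fderiv ℝ f q e) s e' := fun e e' =>
    (((hf2.fderiv_right (m := 1) (by norm_num)).clm_apply contDiff_const).continuous_fderiv
      (by norm_num)).clm_apply continuous_const
  have hA := tendsto_mollify_glueKernel hf2.continuous t
  refine ge_of_tendsto (tendsto_nakanoValue hA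
    (tendsto_finsetSum Finset.univ fun i _ =>
      ((mulVecCLM (u i)).continuous.tendsto _).comp (tendsto_mollify_glueKernel (h1 (e i)) t))
    (tendsto_finsetSum Finset.univ fun i _ => tendsto_finsetSum Finset.univ fun j _ =>
      (((starDotCLM (u j)).comp (mulVecCLM (u i))).continuous.tendsto _).comp
        (tendsto_mollify_glueKernel (h2 (e i) (e j)) t)) hunit) ?_
  obtain ⟨δ, hδ, hδV⟩ := Metric.nhds_basis_closedBall.mem_iff.1 hV
  have hdet : ∀ᶠ ε in 𝓝[>] (0 : ℝ),
      ((∫ y, glueKernel n ε y)⁻¹ • mollify (glueKernel n ε) f t).det ≠ 0 := by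
    have hd : Continuous fun A : Matrix (Fin r) (Fin r) ℂ => A.det := continuous_id.matrix_det
    exact ((hd.tendsto _).comp hA).eventually_ne
      (isUnit_iff_ne_zero.1 ((Matrix.isUnit_iff_isUnit_det _).1 hunit))
  filter_upwards [Ioc_mem_nhdsGT hδ, hdet] with ε hε hdetε
  have hc := inv_pos.2 (integral_glueKernel_pos (n := n) hε.1)
  set c := (∫ y, glueKernel n ε y)⁻¹
  have hu : IsUnit (mollify (glueKernel n ε) f t) := by
    rw [Matrix.isUnit_iff_isUnit_det, isUnit_iff_ne_zero]
    intro h0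
    have h := Matrix.det_smul (mollify (glueKernel n ε) f t) (c : ℂ)
    rw [h0, mul_zero] at h
    exact hdetε h
  obtain ⟨q, hq, hqt⟩ := ht
  have key := hf.nakanoValue_mollify_nonneg hΩ hΩc hGt hpos hN hf2 (contDiff_sub_sum_sq n ε)
    (concaveOn_sub_sum_sq n ε) (isCompact_closedBall 0 ε)
    (fun y hy => mem_closedBall_of_sum_sq_lt hε.1.le hy) (t := t)
    (fun y hy => hδV (by
      rw [mem_closedBall_iff_norm, sub_sub_cancel_left, norm_neg]
      exact (mem_closedBall_zero_iff.1 hy).trans hε.2))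
    ⟨q, hq, by rw [hqt, sub_self]; simpa using pow_pos hε.1 2⟩ hu e u
  have hscale := mul_nonneg hc.le key
  rw [← nakanoValue_smul hc.ne'] at hscale
  convert hscale using 2
  · rfl
  · rw [Finset.smul_sum]
    exact Finset.sum_congr rfl fun i _ => (mulVecCLM (u i)).map_smul c _
  · rw [Finset.smul_sum]
    refine Finset.sum_congr rfl fun i _ => ?_
    rw [Finset.smul_sum]
    exact Finset.sum_congr rfl fun j _ =>
      ((starDotCLM (u j)).comp (mulVecCLM (u i))).map_smul c _

theorem isOpen_setOf_exists_append_mem (hΩ : IsOpen Ω) :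
    IsOpen {t : Fin n → ℝ | ∃ x : Fin m → ℝ, Fin.append t x ∈ Ω} := by
  have h : {t : Fin n → ℝ | ∃ x : Fin m → ℝ, Fin.append t x ∈ Ω} =
      ⋃ x : Fin m → ℝ, (fun t : Fin n → ℝ => (Fin.append t x : Fin (n + m) → ℝ)) ⁻¹' Ω := by
    ext t
    simp
  rw [h]
  refine isOpen_iUnion fun x => hΩ.preimage (continuous_pi fun i => ?_)
  refine Fin.addCases (fun i => ?_) (fun i => ?_) i
  · simpa only [Fin.append_left] using continuous_apply i
  · simpa only [Fin.append_right] using continuous_const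

theorem contDiffOn_matrix {E : Type*} [NormedAddCommGroup E] [NormedSpace ℝ E]
    {g : E → Matrix (Fin r) (Fin r) ℂ} {S : Set E}
    (hg : ∀ a b, ContDiffOn ℝ 2 (fun q => g q a b) S) : ContDiffOn ℝ 2 g S :=
  contDiffOn_pi.2 fun a => contDiffOn_pi.2 fun b => hg a b

theorem IsHermitianMetricReal.nakanoAt {N : ℕ} {Ω : Set (Fin N → ℝ)}
    {g : (Fin N → ℝ) → Matrix (Fin r) (Fin r) ℂ} (hg : IsHermitianMetricReal Ω g) (hΩ : IsOpen Ω)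
    (hN : NakanoSemiPositiveReal Ω g) {q : Fin N → ℝ} (hq : q ∈ Ω) : NakanoAt g q := by
  have h2 := (contDiffOn_matrix hg.2).contDiffAt (hΩ.mem_nhds hq)
  refine nakanoAt_of_basis h2 fun u => ?_
  rw [← nakano_sum_eq h2 (Filter.eventually_of_mem (hΩ.mem_nhds hq) hg.1) u]
  exact hN q hq u

theorem IsHermitianMetricReal.nakanoSemiPositiveReal {N : ℕ} {Ω : Set (Fin N → ℝ)}
    {g : (Fin N → ℝ) → Matrix (Fin r) (Fin r) ℂ} (hg : IsHermitianMetricReal Ω g) (hΩ : IsOpen Ω)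
    (hN : ∀ q ∈ Ω, NakanoAt g q) : NakanoSemiPositiveReal Ω g := fun q hq u => by
  have h2 := (contDiffOn_matrix hg.2).contDiffAt (hΩ.mem_nhds hq)
  rw [nakano_sum_eq h2 (Filter.eventually_of_mem (hΩ.mem_nhds hq) hg.1) u]
  exact hN q hq _ _ _

theorem exists_contDiff_eq_on_ball {D : Set (Fin n → ℝ)} (hD : IsOpen D) (hf : ContDiffOn ℝ 2 f D)
    {t : Fin n → ℝ} (ht : t ∈ D) : ∃ h : (Fin n → ℝ) → Matrix (Fin r) (Fin r) ℂ,
      ContDiff ℝ 2 h ∧ ∃ V ∈ 𝓝 t, V ⊆ D ∧ ∀ s ∈ V, h s = f s := by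
  obtain ⟨R, hR, hRD⟩ := Metric.nhds_basis_closedBall.mem_iff.1 (hD.mem_nhds ht)
  let θ : ContDiffBump t := ⟨R / 2, R, half_pos hR, half_lt_self hR⟩
  refine ⟨fun s => θ s • f s, contDiff_smul_of_eq_zero_off_compact θ.contDiff hD
    (isCompact_closedBall t R) hRD (fun s hs => θ.zero_of_le_dist ?_) hf,
    Metric.closedBall t (R / 2), Metric.closedBall_mem_nhds t (half_pos hR),
    (Metric.closedBall_subset_closedBall (half_le_self hR.le)).trans hRD, fun s hs => ?_⟩
  · exact (not_le.1 hs).le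
  · simp only [θ.one_of_mem_closedBall hs, one_smul]

end Conclusion

/-- **Matrix-valued Prekopa theorem on convex domains.**
Points of `ℝⁿ_t × ℝᵐ_x` are modeled as `Fin (n+m) → ℝ` via `Fin.append`. -/
theorem invariant_direct_image_real_convex {n m r : ℕ}
    (Ω₀ : Set (Fin (n + m) → ℝ))
    (hΩ₀_open : IsOpen Ω₀) (hΩ₀_conv : Convex ℝ Ω₀) (hΩ₀_ne : Ω₀.Nonempty)
    (D₀ : Set (Fin n → ℝ))
    (hD₀ : D₀ = {t : Fin n → ℝ | ∃ x : Fin m → ℝ, Fin.append t x ∈ Ω₀})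
    -- the Hermitian metric `g̃` on `Ẽ₀ = Ω₀ × ℂʳ`
    (Gt : (Fin (n + m) → ℝ) → Matrix (Fin r) (Fin r) ℂ)
    (hGt : IsHermitianMetricReal Ω₀ Gt)
    -- the fiberwise integrated metric `g` on `E₀ = D₀ × ℂʳ`
    (G : (Fin n → ℝ) → Matrix (Fin r) (Fin r) ℂ)
    (hG : ∀ t ∈ D₀, ∀ a b : Fin r,
      G t a b = ∫ x in {x : Fin m → ℝ | Fin.append t x ∈ Ω₀}, Gt (Fin.append t x) a b)
    (hG_metric : IsHermitianMetricReal D₀ G)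
    (hNakano : NakanoSemiPositiveReal Ω₀ Gt) :
    NakanoSemiPositiveReal D₀ G := by
  have hD : IsOpen D₀ := hD₀ ▸ isOpen_setOf_exists_append_mem hΩ₀_open
  refine hG_metric.nakanoSemiPositiveReal hD fun t ht => ?_
  obtain ⟨f, hf, V, hV, hVD, hfG⟩ :=
    exists_contDiff_eq_on_ball hD (contDiffOn_matrix hG_metric.2) ht
  have hfib : IsFiberIntegral Ω₀ Gt V f := fun s hs => by
    rw [hfG s hs]
    exact ⟨hG_metric.1 s (hVD hs), hG s (hVD hs)⟩
  have hbase : ∃ q ∈ Ω₀, baseProj n m q = t := by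
    rw [hD₀] at ht
    obtain ⟨x, hx⟩ := ht
    exact ⟨_, hx, baseProj_append t x⟩
  refine (hfib.nakanoAt hΩ₀_open hΩ₀_conv (contDiffOn_matrix hGt.2) hGt.1
    (fun q hq => hGt.nakanoAt hΩ₀_open hNakano hq) hf hV hbase).congr_of_eventuallyEq ?_
  filter_upwards [hV] with s hs
  exact hfG s hs

end
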